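/- arXiv:2507.05037 — 7 statements merged into one kernel-verified Lean document; each statement's English description precedes it below -/
import Mathlib

section
/- In the projective plane PG(2,3), a set of points is a projective triangle of side 3 if and only if it is a vertexless triangle. -/
abbrev Pt (F : Type) [Field F] : Type :=
  {P : Submodule F (Fin 3 → F) // Module.finrank F ↥P = 1}

abbrev Ln (F : Type) [Field F] : Type :=
  {L : Submodule F (Fin 3 → F) // Module.finrank F ↥L = 2}

variable {F : Type} [Field F]

def Incid (P : Pt F) (L : Ln F) : Prop := P.1 ≤ L.1

def IsTangent (K : Set (Pt F)) (L : Ln F) : Prop := ∃! P : Pt F, P ∈ K ∧ Incid P L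

def IsSecant (K : Set (Pt F)) (L : Ln F) : Prop :=
  ∃ P Q : Pt F, P ≠ Q ∧ P ∈ K ∧ Q ∈ K ∧ Incid P L ∧ Incid Q L

def IsBlocking (B : Set (Pt F)) : Prop :=
  (∀ L : Ln F, ∃ P ∈ B, Incid P L) ∧ (∀ L : Ln F, ∃ P : Pt F, Incid P L ∧ P ∉ B)

def IsMinimalBlocking (B : Set (Pt F)) : Prop :=
  IsBlocking B ∧ ∀ B' : Set (Pt F), B' ⊂ B → ¬ IsBlocking B'

def IsSemioval (K : Set (Pt F)) : Prop :=
  ∀ P ∈ K, ∃! L : Ln F, Incid P L ∧ IsTangent K L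

def HasRInftyAt (B : Set (Pt F)) (P : Pt F) : Prop :=
  ∃ r : Ln F, Incid P r ∧ IsTangent B r ∧
    ∀ L : Ln F, Incid P L → L ≠ r → IsSecant B L

def NonConcurrent (a b c : Ln F) : Prop :=
  ¬ ∃ P : Pt F, Incid P a ∧ Incid P b ∧ Incid P c

def VertexlessTriangle (a b c : Ln F) : Set (Pt F) :=
  {P | (Incid P a ∧ ¬ Incid P b ∧ ¬ Incid P c) ∨
       (¬ Incid P a ∧ Incid P b ∧ ¬ Incid P c) ∨
       (¬ Incid P a ∧ ¬ Incid P b ∧ Incid P c)}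

def AffPts (l m : Ln F) : Set (Pt F) := {P | Incid P m ∧ ¬ Incid P l}

def IsAffBlocking (l : Ln F) (B : Set (Pt F)) : Prop :=
  (∀ P ∈ B, ¬ Incid P l) ∧ (∀ m : Ln F, m ≠ l → ∃ P ∈ B, Incid P m)

def IsMinimalAffBlocking (l : Ln F) (B : Set (Pt F)) : Prop :=
  IsAffBlocking l B ∧ ∀ B' : Set (Pt F), B' ⊂ B → ¬ IsAffBlocking l B'

def PiProp (l : Ln F) (Pinf : Pt F) (B : Set (Pt F)) : Prop :=
  (∀ Q ∈ B, ∃ m : Ln F, m ≠ l ∧ ¬ Incid Pinf m ∧ Incid Q m ∧ IsTangent B m) ∧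
  (∀ m : Ln F, m ≠ l → Incid Pinf m → ¬ (AffPts l m ⊆ B))

def PiStrong (l : Ln F) (Pinf : Pt F) (B : Set (Pt F)) : Prop :=
  (∀ Q ∈ B, ∃! m : Ln F, m ≠ l ∧ ¬ Incid Pinf m ∧ Incid Q m ∧ IsTangent B m) ∧
  (∀ m : Ln F, m ≠ l → Incid Pinf m → ¬ (AffPts l m ⊆ B))


/-- A projective triangle of side `n`: a set of `3(n-1)` points with `n` points of the set
on each side of some triangle `P0 P1 P2`, the vertices in the set, and closed under the
operation `Q0 Q1 ↦ Q0Q1 ∩ P0P1` for `Q0` on `P1P2` and `Q1` on `P2P0`. -/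
def IsProjTriangle {F : Type} [Field F] (n : ℕ) (B : Set (Pt F)) : Prop :=
  B.ncard = 3 * (n - 1) ∧
  ∃ (P0 P1 P2 : Pt F) (l01 l12 l20 : Ln F),
    P0 ≠ P1 ∧ P1 ≠ P2 ∧ P0 ≠ P2 ∧
    (¬ ∃ m : Ln F, Incid P0 m ∧ Incid P1 m ∧ Incid P2 m) ∧
    Incid P0 l01 ∧ Incid P1 l01 ∧
    Incid P1 l12 ∧ Incid P2 l12 ∧
    Incid P2 l20 ∧ Incid P0 l20 ∧
    (B ∩ {P : Pt F | Incid P l12}).ncard = n ∧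
    (B ∩ {P : Pt F | Incid P l20}).ncard = n ∧
    (B ∩ {P : Pt F | Incid P l01}).ncard = n ∧
    P0 ∈ B ∧ P1 ∈ B ∧ P2 ∈ B ∧
    (∀ Q0 ∈ B, ∀ Q1 ∈ B, Incid Q0 l12 → Incid Q1 l20 → Q0 ≠ Q1 →
      ∀ m : Ln F, Incid Q0 m → Incid Q1 m → m ≠ l01 →
        ∀ Q2 : Pt F, Incid Q2 m → Incid Q2 l01 → Q2 ∈ B)


def pgInc (i j : Fin 13) : Bool := Nat.testBit 523 ((i.val + 13 - j.val) % 13)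

def pgD (d : ℕ) : ℕ := (18250273403664 >>> (4 * d)) % 16

def pgJoin (i k : Fin 13) : Fin 13 :=
  ⟨(i.val + 13 - pgD ((i.val + 13 - k.val) % 13)) % 13, Nat.mod_lt _ (by norm_num)⟩

def pgMeet (j k : Fin 13) : Fin 13 :=
  ⟨(j.val + pgD ((k.val + 13 - j.val) % 13)) % 13, Nat.mod_lt _ (by norm_num)⟩

def pgVec : Fin 13 → Fin 3 → ZMod 3 :=
  ![![1, 0, 0], ![0, 1, 0], ![0, 0, 1], ![2, 1, 0], ![0, 2, 1], ![2, 1, 2], ![1, 1, 1], ![2, 2, 1], ![2, 0, 2], ![1, 1, 0], ![0, 1, 1], ![2, 1, 1], ![2, 0, 1]]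

def pgCov : Fin 13 → Fin 3 → ZMod 3 :=
  ![![0, 0, 1], ![1, 0, 0], ![1, 1, 0], ![1, 1, 1], ![0, 1, 1], ![1, 0, 2], ![1, 2, 0], ![1, 1, 2], ![1, 2, 2], ![1, 2, 1], ![0, 1, 2], ![1, 0, 1], ![0, 1, 0]]

def pgVT (a b c i : Fin 13) : Bool :=
  (pgInc i a && !pgInc i b && !pgInc i c) || (!pgInc i a && pgInc i b && !pgInc i c) ||
    (!pgInc i a && !pgInc i b && pgInc i c)

def pgNC (a b c : Fin 13) : Prop := ∀ i, ¬ (pgInc i a = true ∧ pgInc i b = true ∧ pgInc i c = true)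

instance (a b c : Fin 13) : Decidable (pgNC a b c) := by unfold pgNC; infer_instance

theorem pgInc_iff : ∀ i j : Fin 13, pgInc i j = true ↔
    pgCov j 0 * pgVec i 0 + pgCov j 1 * pgVec i 1 + pgCov j 2 * pgVec i 2 = 0 := by decide +kernel

theorem pgVec_ne : ∀ i, pgVec i ≠ 0 := by decide +kernel
theorem pgCov_ne : ∀ i, pgCov i ≠ 0 := by decide +kernel

theorem pgVec_surj : ∀ w : Fin 3 → ZMod 3, w ≠ 0 → ∃ i, w = pgVec i ∨ w = - pgVec i := by
  decide +kernel
theorem pgCov_surj : ∀ w : Fin 3 → ZMod 3, w ≠ 0 → ∃ i, w = pgCov i ∨ w = - pgCov i := by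
  decide +kernel

theorem pgPt_inj : ∀ i k : Fin 13, (∀ j, pgInc i j = pgInc k j) → i = k := by decide +kernel
theorem pgLn_inj : ∀ i k : Fin 13, (∀ j, pgInc j i = pgInc j k) → i = k := by decide +kernel

theorem pgJoin_eq : ∀ i k j : Fin 13, i ≠ k → pgInc i j = true → pgInc k j = true →
    j = pgJoin i k := by decide +kernel
theorem pgMeet_eq : ∀ i k j : Fin 13, i ≠ k → pgInc j i = true → pgInc j k = true →
    j = pgMeet i k := by decide +kernel
theorem pgJoin_inc : ∀ i k : Fin 13, i ≠ k →
    pgInc i (pgJoin i k) = true ∧ pgInc k (pgJoin i k) = true := by decide +kernel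

theorem pgInc_shift : ∀ t i j : Fin 13, pgInc (i + t) (j + t) = pgInc i j := by decide +kernel

theorem pgFwd : ∀ P1 : Fin 13, (0 : Fin 13) ≠ P1 → ∀ P2 : Fin 13, pgInc P2 (pgJoin 0 P1) = false →
    ∀ Q0 : Fin 13, pgInc Q0 (pgJoin P1 P2) = true → Q0 ≠ P1 → Q0 ≠ P2 →
    ∀ Q1 : Fin 13, pgInc Q1 (pgJoin P2 0) = true → Q1 ≠ P2 → Q1 ≠ 0 →
    Q0 ≠ Q1 ∧ pgJoin Q0 Q1 ≠ pgJoin 0 P1 ∧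
    pgInc Q0 (pgJoin Q0 Q1) = true ∧ pgInc Q1 (pgJoin Q0 Q1) = true ∧
    pgInc (pgMeet (pgJoin Q0 Q1) (pgJoin 0 P1)) (pgJoin Q0 Q1) = true ∧
    pgInc (pgMeet (pgJoin Q0 Q1) (pgJoin 0 P1)) (pgJoin 0 P1) = true ∧
    [0, P1, P2, Q0, Q1, pgMeet (pgJoin Q0 Q1) (pgJoin 0 P1)].Nodup ∧
    pgNC (pgJoin 0 Q0) (pgJoin P1 Q1) (pgJoin P2 (pgMeet (pgJoin Q0 Q1) (pgJoin 0 P1))) ∧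
    ∀ i, i ∈ [0, P1, P2, Q0, Q1, pgMeet (pgJoin Q0 Q1) (pgJoin 0 P1)] ↔
     pgVT (pgJoin 0 Q0) (pgJoin P1 Q1) (pgJoin P2 (pgMeet (pgJoin Q0 Q1) (pgJoin 0 P1))) i = true := by
  decide +kernel

theorem pgRev : ∀ b c : Fin 13, pgNC 0 b c →
    (Finset.univ.filter fun i => pgVT 0 b c i = true).card = 6 ∧
    ∃ P0, pgVT 0 b c P0 = true ∧ ∃ P1, pgVT 0 b c P1 = true ∧ P0 ≠ P1 ∧ 
      ∃ P2, pgVT 0 b c P2 = true ∧ pgInc P2 (pgJoin P0 P1) = false ∧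
      (Finset.univ.filter fun i => pgVT 0 b c i = true ∧ pgInc i (pgJoin P1 P2) = true).card = 3 ∧
      (Finset.univ.filter fun i => pgVT 0 b c i = true ∧ pgInc i (pgJoin P2 P0) = true).card = 3 ∧
      (Finset.univ.filter fun i => pgVT 0 b c i = true ∧ pgInc i (pgJoin P0 P1) = true).card = 3 ∧
      ∀ Q0, pgInc Q0 (pgJoin P1 P2) = true → pgVT 0 b c Q0 = true →
      ∀ Q1, pgInc Q1 (pgJoin P2 P0) = true → pgVT 0 b c Q1 = true → Q0 ≠ Q1 →
        pgJoin Q0 Q1 ≠ pgJoin P0 P1 → 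
        pgVT 0 b c (pgMeet (pgJoin Q0 Q1) (pgJoin P0 P1)) = true := by
  decide +kernel

noncomputable def pgDot {F : Type} [Field F] (u : Fin 3 → F) : (Fin 3 → F) →ₗ[F] F :=
  u 0 • LinearMap.proj 0 + u 1 • LinearMap.proj 1 + u 2 • LinearMap.proj 2

theorem pgDot_apply {F : Type} [Field F] (u v : Fin 3 → F) :
    pgDot u v = u 0 * v 0 + u 1 * v 1 + u 2 * v 2 := by simp [pgDot]

theorem pgDot_ker {F : Type} [Field F] (f : (Fin 3 → F) →ₗ[F] F) (hf : f ≠ 0) :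
    Module.finrank F (LinearMap.ker f) = 2 := by
  have h := LinearMap.finrank_range_add_finrank_ker f
  rw [LinearMap.range_eq_top.2 (LinearMap.surjective hf), finrank_top] at h
  simp at h
  omega

theorem pgDot_exists {F : Type} [Field F] (f : (Fin 3 → F) →ₗ[F] F) : ∃ u, f = pgDot u := by
  refine ⟨fun i => f (Pi.single i 1), ?_⟩
  apply LinearMap.pi_ext'
  intro i
  ext
  fin_cases i <;> simp [pgDot_apply]

theorem pgDot_ne {F : Type} [Field F] (u : Fin 3 → F) (hu : u ≠ 0) : pgDot u ≠ 0 := by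
  intro h
  apply hu
  funext i
  have := congrArg (fun f => f (Pi.single i 1)) h
  fin_cases i <;> simpa [pgDot_apply] using this

theorem pgModel (F : Type) [Field F] [Fintype F] (hq : Fintype.card F = 3) :
    ∃ (p : Fin 13 → Pt F) (l : Fin 13 → Ln F), p.Surjective ∧ l.Surjective ∧
      ∀ i j, Incid (p i) (l j) ↔ pgInc i j = true := by
  classical
  have : Fact (Nat.Prime 3) := ⟨by norm_num⟩
  let e : ZMod 3 ≃+* F := ZMod.ringEquivOfPrime F (by norm_num) hq
  have e0 : ∀ w : Fin 3 → ZMod 3, w ≠ 0 → (fun k => e (w k)) ≠ 0 := by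
    intro w hw h
    apply hw
    funext k
    have := congrFun h k
    simpa using this
  have es : ∀ v : Fin 3 → F, v ≠ 0 → ∃ w : Fin 3 → ZMod 3, w ≠ 0 ∧ v = fun k => e (w k) := by
    intro v hv
    refine ⟨fun k => e.symm (v k), ?_, by simp⟩
    intro h
    apply hv
    funext k
    have := congrFun h k
    simpa using this
  refine ⟨fun i => ⟨Submodule.span F {fun k => e (pgVec i k)}, finrank_span_singleton (e0 _ (pgVec_ne i))⟩,
    fun j => ⟨LinearMap.ker (pgDot fun k => e (pgCov j k)), pgDot_ker _ (pgDot_ne _ (e0 _ (pgCov_ne j)))⟩, ?_, ?_, ?_⟩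
  · rintro ⟨P, hP⟩
    obtain ⟨v, hv, hs⟩ := finrank_eq_one_iff'.1 hP
    have hPs : P = Submodule.span F {(v : Fin 3 → F)} := by
      apply le_antisymm
      · intro x hx
        obtain ⟨c, hc⟩ := hs ⟨x, hx⟩
        rw [Submodule.mem_span_singleton]
        exact ⟨c, congrArg Subtype.val hc⟩
      · rw [Submodule.span_singleton_le_iff_mem]; exact v.2
    have hv' : (v : Fin 3 → F) ≠ 0 := by simpa using hv
    obtain ⟨w, hw, hvw⟩ := es _ hv'
    obtain ⟨i, hi⟩ := pgVec_surj w hw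
    refine ⟨i, Subtype.ext ?_⟩
    change _ = P
    rw [hPs, hvw]
    rcases hi with rfl | rfl
    · rfl
    · have : (fun k => e ((-pgVec i) k)) = -(fun k => e (pgVec i k)) := by
        funext k; simp
      rw [this]
      exact (Submodule.span_singleton_eq_span_singleton.2 ⟨-1, by simp⟩)
  · rintro ⟨L, hL⟩
    have hlt : L < ⊤ := by
      rw [lt_top_iff_ne_top]
      rintro rfl
      simp at hL
    obtain ⟨f, hf, hle⟩ := Submodule.exists_le_ker_of_lt_top L hlt
    have hLf : L = LinearMap.ker f :=
      Submodule.eq_of_le_of_finrank_eq hle (by rw [hL, pgDot_ker f hf])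
    obtain ⟨u, rfl⟩ := pgDot_exists f
    have hu : u ≠ 0 := by
      rintro rfl
      exact hf (by ext; simp [pgDot_apply])
    obtain ⟨w, hw, hvw⟩ := es _ hu
    obtain ⟨i, hi⟩ := pgCov_surj w hw
    refine ⟨i, Subtype.ext ?_⟩
    change _ = L
    rw [hLf, hvw]
    rcases hi with rfl | rfl
    · rfl
    · ext x
      simp only [LinearMap.mem_ker, pgDot_apply, Pi.neg_apply, map_neg]
      constructor <;> intro h <;> linear_combination -h
  · intro i j
    unfold Incid
    simp only
    rw [Submodule.span_singleton_le_iff_mem, LinearMap.mem_ker, pgDot_apply, pgInc_iff]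
    simp only [← map_mul, ← map_add]
    exact map_eq_zero_iff e e.injective

theorem pgModel_shift {F : Type} [Field F] {p : Fin 13 → Pt F} {l : Fin 13 → Ln F}
    (hp : p.Surjective) (hl : l.Surjective) (h : ∀ i j, Incid (p i) (l j) ↔ pgInc i j = true)
    (t : Fin 13) :
    ∃ (p' : Fin 13 → Pt F) (l' : Fin 13 → Ln F), p'.Surjective ∧ l'.Surjective ∧
      (∀ i j, Incid (p' i) (l' j) ↔ pgInc i j = true) ∧ p' 0 = p t ∧ l' 0 = l t := by
  refine ⟨fun i => p (i + t), fun i => l (i + t), ?_, ?_, ?_, by simp, by simp⟩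
  · exact hp.comp (Equiv.addRight t).surjective
  · exact hl.comp (Equiv.addRight t).surjective
  · intro i j; rw [h, pgInc_shift]

theorem pgInj {F : Type} [Field F] {p : Fin 13 → Pt F} {l : Fin 13 → Ln F}
    (h : ∀ i j, Incid (p i) (l j) ↔ pgInc i j = true) : p.Injective ∧ l.Injective := by
  constructor
  · intro i k hik
    apply pgPt_inj
    intro j
    rw [Bool.eq_iff_iff, ← h, ← h, hik]
  · intro i k hik
    apply pgLn_inj
    intro j
    rw [Bool.eq_iff_iff, ← h, ← h, hik]

theorem pgThird {α : Type} (A : Set α) (h : A.ncard = 3) (x y : α) : ∃ z ∈ A, z ≠ x ∧ z ≠ y := by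
  classical
  by_contra! hc
  have hsub : A ⊆ (({x, y} : Finset α) : Set α) := by
    intro z hz
    by_cases hzx : z = x
    · simp [hzx]
    · simp [hc z hz hzx]
  have h1 := Set.ncard_le_ncard hsub (Finset.finite_toSet _)
  rw [Set.ncard_coe_finset] at h1
  have := Finset.card_le_two (a := x) (b := y)
  omega

theorem pgVT_iff {F : Type} [Field F] {p : Fin 13 → Pt F} {l : Fin 13 → Ln F}
    (h : ∀ i j, Incid (p i) (l j) ↔ pgInc i j = true) (a b c i : Fin 13) :
    p i ∈ VertexlessTriangle (l a) (l b) (l c) ↔ pgVT a b c i = true := by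
  simp only [VertexlessTriangle, Set.mem_ofPred_eq, h, pgVT]
  simp
  tauto

theorem pgNC_iff {F : Type} [Field F] {p : Fin 13 → Pt F} {l : Fin 13 → Ln F}
    (hp : p.Surjective)
    (h : ∀ i j, Incid (p i) (l j) ↔ pgInc i j = true) (a b c : Fin 13) :
    NonConcurrent (l a) (l b) (l c) ↔ pgNC a b c := by
  unfold NonConcurrent pgNC
  rw [hp.exists]
  simp only [h, not_exists]

theorem pgCard {F : Type} [Field F] {p : Fin 13 → Pt F} (hp : p.Bijective)
    (S : Set (Pt F)) (f : Fin 13 → Prop) [DecidablePred f] (hS : ∀ i, p i ∈ S ↔ f i) :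
    S.ncard = (Finset.univ.filter f).card := by
  have : S = p '' ((Finset.univ.filter f : Finset (Fin 13)) : Set (Fin 13)) := by
    ext P
    obtain ⟨i, rfl⟩ := hp.2 P
    rw [hp.1.mem_set_image, hS]
    simp
  rw [this, Set.ncard_image_of_injective _ hp.1, Set.ncard_coe_finset]

/-- In PG(2,3), a set of points is a projective triangle of side 3 iff it is a
vertexless triangle. -/
theorem projTriangle_iff_vertexlessTriangle
    (F : Type) [Field F] [Fintype F] (hq : Fintype.card F = 3) (S : Set (Pt F)) :
    IsProjTriangle 3 S ↔
      ∃ a b c : Ln F, NonConcurrent a b c ∧ S = VertexlessTriangle a b c := by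
  classical
  obtain ⟨p₀, l₀, hp₀, hl₀, h₀⟩ := pgModel F hq
  constructor
  · rintro ⟨hcard, P0, P1, P2, l01, l12, l20, n01, n12, n02, hnc, i1, i2, i3, i4, i5, i6,
      c12, c20, c01, m0, m1, m2, hcl⟩
    obtain ⟨Q0, ⟨hQ0S, hQ0l⟩, q01, q02⟩ := pgThird _ c12 P1 P2
    obtain ⟨Q1, ⟨hQ1S, hQ1l⟩, q12, q10⟩ := pgThird _ c20 P2 P0
    obtain ⟨t, ht0⟩ := hp₀ P0
    obtain ⟨p, l, hp, hl, h, ht, -⟩ := pgModel_shift hp₀ hl₀ h₀ t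
    obtain rfl : P0 = p 0 := by rw [ht, ht0]
    obtain ⟨pi, li⟩ := pgInj h
    obtain ⟨P1, rfl⟩ := hp P1
    obtain ⟨P2, rfl⟩ := hp P2
    obtain ⟨Q0, rfl⟩ := hp Q0
    obtain ⟨Q1, rfl⟩ := hp Q1
    obtain ⟨l01, rfl⟩ := hl l01
    obtain ⟨l12, rfl⟩ := hl l12
    obtain ⟨l20, rfl⟩ := hl l20
    simp only [Set.mem_ofPred_eq] at hQ0l hQ1l
    simp only [h, pi.ne_iff] at i1 i2 i3 i4 i5 i6 n01 n12 n02 q01 q02 q12 q10 hQ0l hQ1l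
    obtain rfl := pgJoin_eq _ _ _ n01 i1 i2
    obtain rfl := pgJoin_eq _ _ _ n12 i3 i4
    obtain rfl := pgJoin_eq _ _ _ n02.symm i5 i6
    have hP2 : pgInc P2 (pgJoin 0 P1) = false := by
      rw [Bool.eq_false_iff]
      intro hh
      exact hnc ⟨l (pgJoin 0 P1), (h _ _).2 i1, (h _ _).2 i2, (h _ _).2 hh⟩
    obtain ⟨r1, r2, r3, r4, r5, r6, r7, r8, r9⟩ :=
      pgFwd P1 n01 P2 hP2 Q0 hQ0l q01 q02 Q1 hQ1l q12 q10
    have hQ2 := hcl _ hQ0S _ hQ1S ((h _ _).2 hQ0l) ((h _ _).2 hQ1l) (pi.ne r1) _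
      ((h _ _).2 r3) ((h _ _).2 r4) (li.ne r2) _ ((h _ _).2 r5) ((h _ _).2 r6)
    refine ⟨_, _, _, (pgNC_iff hp h _ _ _).2 r8, ?_⟩
    generalize pgMeet (pgJoin Q0 Q1) (pgJoin 0 P1) = Q2 at *
    have hT : p '' (([0, P1, P2, Q0, Q1, Q2].toFinset : Finset (Fin 13)) : Set (Fin 13)) = S := by
      apply Set.eq_of_subset_of_ncard_le
      · rintro _ ⟨i, hi, rfl⟩
        simp only [List.coe_toFinset, List.mem_cons, List.not_mem_nil, or_false,
          Set.mem_ofPred_eq] at hi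
        rcases hi with rfl | rfl | rfl | rfl | rfl | rfl <;> assumption
      · rw [Set.ncard_image_of_injective _ pi, Set.ncard_coe_finset, List.toFinset_card_of_nodup r7,
          hcard]
        simp
      · exact Set.finite_of_ncard_ne_zero (by rw [hcard]; norm_num)
    rw [← hT]
    ext P
    obtain ⟨i, rfl⟩ := hp P
    rw [pi.mem_set_image, pgVT_iff h, ← r9]
    simp
  · rintro ⟨a, b, c, hnc, rfl⟩
    obtain ⟨t, ht0⟩ := hl₀ a
    obtain ⟨p, l, hp, hl, h, -, ht⟩ := pgModel_shift hp₀ hl₀ h₀ t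
    obtain rfl : a = l 0 := by rw [ht, ht0]
    obtain ⟨pi, li⟩ := pgInj h
    obtain ⟨b, rfl⟩ := hl b
    obtain ⟨c, rfl⟩ := hl c
    rw [pgNC_iff hp h] at hnc
    obtain ⟨hc, P0, m0, P1, m1, n01, P2, m2, hn, c1, c2, c3, hcl⟩ := pgRev b c hnc
    obtain ⟨j1, j2⟩ := pgJoin_inc P0 P1 n01
    have n12 : P1 ≠ P2 := by rintro rfl; simp [j2] at hn
    have n20 : P2 ≠ P0 := by rintro rfl; simp [j1] at hn
    obtain ⟨j3, j4⟩ := pgJoin_inc P1 P2 n12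
    obtain ⟨j5, j6⟩ := pgJoin_inc P2 P0 n20
    have hv := pgVT_iff h 0 b c
    refine ⟨(pgCard ⟨pi, hp⟩ _ _ hv).trans hc, p P0, p P1, p P2, l (pgJoin P0 P1),
      l (pgJoin P1 P2), l (pgJoin P2 P0), pi.ne n01, pi.ne n12, pi.ne n20.symm, ?_,
      (h _ _).2 j1, (h _ _).2 j2, (h _ _).2 j3, (h _ _).2 j4, (h _ _).2 j5, (h _ _).2 j6,
      (pgCard ⟨pi, hp⟩ _ _ ?_).trans c1, (pgCard ⟨pi, hp⟩ _ _ ?_).trans c2,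
      (pgCard ⟨pi, hp⟩ _ _ ?_).trans c3, (hv _).2 m0, (hv _).2 m1, (hv _).2 m2, ?_⟩
    · rintro ⟨m, k0, k1, k2⟩
      obtain ⟨m, rfl⟩ := hl m
      rw [h] at k0 k1 k2
      obtain rfl := pgJoin_eq _ _ _ n01 k0 k1
      simp [k2] at hn
    · intro i; rw [Set.mem_inter_iff, hv, Set.mem_ofPred_eq, h]
    · intro i; rw [Set.mem_inter_iff, hv, Set.mem_ofPred_eq, h]
    · intro i; rw [Set.mem_inter_iff, hv, Set.mem_ofPred_eq, h]
    · intro Q0 s0 Q1 s1 k0 k1 hne m e0 e1 hm Q2 e2 e3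
      obtain ⟨Q0, rfl⟩ := hp Q0
      obtain ⟨Q1, rfl⟩ := hp Q1
      obtain ⟨Q2, rfl⟩ := hp Q2
      obtain ⟨m, rfl⟩ := hl m
      rw [hv] at s0 s1 ⊢
      rw [h] at k0 k1 e0 e1 e2 e3
      have hne' : Q0 ≠ Q1 := fun hh => hne (by rw [hh])
      have hm' : m ≠ pgJoin P0 P1 := fun hh => hm (by rw [hh])
      obtain rfl := pgJoin_eq _ _ _ hne' e0 e1
      obtain rfl := pgMeet_eq _ _ _ hm' e2 e3
      exact hcl Q0 k0 s0 Q1 k1 s1 hne' hm'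
end

section
/- In the projective plane PG(2,3), every minimal blocking set is a vertexless triangle; consequently, every minimal blocking set of PG(2,3) has the r∞-property with respect to every one of its points. -/
variable {F : Type} [Field F]

namespace PG23

def tv : Fin 13 → Fin 3 → ZMod 3 :=
  ![![1,0,0], ![0,1,0], ![0,0,1], ![1,1,0], ![1,2,0], ![1,0,1], ![1,0,2], ![0,1,1], ![0,1,2],
    ![1,1,1], ![1,1,2], ![1,2,1], ![1,2,2]]

/-- masks of the points on each line -/
def tab : List ℕ := [390, 101, 27, 6164, 1548, 5186, 2594, 3329, 4737, 848, 1200, 2248, 4392]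

def mk (j : Fin 13) : ℕ := tab.getD j.val 0

def I (i j : Fin 13) : Bool := Nat.testBit (mk j) i.val

theorem I_iff : ∀ i j, I i j = true ↔
    tv j 0 * tv i 0 + tv j 1 * tv i 1 + tv j 2 * tv i 2 = 0 := by decide +kernel

theorem tv_ne : ∀ i, tv i ≠ 0 := by decide +kernel

theorem tv_surj : ∀ x y z : ZMod 3, (x ≠ 0 ∨ y ≠ 0 ∨ z ≠ 0) → ∃ i, ∃ u : ZMod 3, u ≠ 0 ∧
    x = u * tv i 0 ∧ y = u * tv i 1 ∧ z = u * tv i 2 := by decide +kernel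

theorem I_inj1 : ∀ i j, (∀ k, I i k = I j k) → i = j := by decide +kernel
theorem I_inj2 : ∀ i j, (∀ k, I k i = I k j) → i = j := by decide +kernel

/-- masks of the vertexless triangles -/
def tl : List ℕ :=
  [504, 5537, 3009, 3298, 4962, 691, 1363, 2347, 4299, 6537, 1937, 3228, 4892, 717, 1325, 2389,
  4277, 3536, 5040, 5267, 2835, 6850, 7458, 4442, 2234, 5064, 3496, 2699, 5387, 1242, 826,
  3906, 5794, 6341, 1861, 5780, 4468, 7436, 1260, 1701, 6437, 2292, 3860, 876, 6796, 7686,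
  2103, 1103, 4183, 559, 1638, 2590, 5150, 6246, 6250, 1650, 5180, 2652, 814, 1230, 2230, 4438,
  3123, 4691, 5488, 2800, 6945, 7361, 4281, 2393, 4651, 3147, 2920, 5352, 1337, 729, 3745,
  5953, 7685, 6438, 1702, 4247, 1295, 1862, 6342, 2327, 655, 3636, 2516, 1452, 7244, 4532,
  5716, 6700, 972, 1925, 4637, 3101, 6533, 7683, 3149, 4653, 5390, 2702, 4295, 2343, 4693,
  3125, 2838, 5270, 1351, 679, 6488, 1752, 5897, 4329, 7313, 1393, 1848, 6328, 2409, 3721, 753,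
  6929, 3658, 2474, 1490, 7218, 4554, 5674, 6738, 946, 2947, 4707, 3171, 5507, 2650, 5178,
  4889, 3225, 7496, 6824, 5840, 3888, 1652, 343, 3846, 2278, 1182, 183, 4454, 5766, 798, 1940,
  5701, 4517, 1085, 2501, 3621, 605, 5004, 2668, 5228, 3468, 500, 6252, 207, 4382, 6790, 870,
  303, 2206, 1254, 7430, 6540, 2141, 965, 6693, 4157, 7237, 1445, 492, 3476, 5236, 2676, 5012,
  4961, 3297, 7472, 6864, 5800, 3912, 3010, 6675, 4491, 2155, 1427, 627, 3595, 5026, 1594,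
  6202, 474, 3490, 5538, 1139, 915, 5643, 7187, 4203, 2443, 3522, 442, 6234, 1626, 5058, 7376,
  6960, 5960, 3752, 2785, 1689, 377, 6297, 5345, 5473, 6425, 249, 1817, 2913, 3880, 5832, 6832,
  7504]

def triT : List ℕ :=
  (List.finRange 13).flatMap fun x => (List.finRange 13).flatMap fun y =>
    ((List.finRange 13).filter fun z => decide (x < y) && decide (y < z) &&
      Nat.beq (Nat.land (Nat.land (mk x) (mk y)) (mk z)) 0).map fun z =>
        Nat.xor (Nat.xor (mk x) (mk y)) (mk z)

theorem triT_eq : tl = triT := by decide +kernel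

def chk (m : ℕ) : Bool :=
  tab.any (fun l => Nat.beq (Nat.land m l) 0 || Nat.beq (Nat.land m l) l) ||
    tl.any (fun t => Nat.beq (Nat.land m t) t)

def allm : ℕ → ℕ → Bool
  | 0, m => chk m
  | n + 1, m => allm n (2 * m) && allm n (2 * m + 1)

theorem allm_spec : ∀ n p, allm n p = true → ∀ m, m / 2 ^ n = p → chk m = true
  | 0, p, h, m, hm => by
    simp at hm
    subst hm
    exact h
  | n + 1, p, h, m, hm => by
    simp only [allm, Bool.and_eq_true] at h
    have h2 : (m / 2 ^ n) / 2 = p := by rw [Nat.div_div_eq_div_mul, ← pow_succ, hm]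
    rcases Nat.mod_two_eq_zero_or_one (m / 2 ^ n) with h3 | h3
    · exact allm_spec n _ h.1 m (by omega)
    · exact allm_spec n _ h.2 m (by omega)

theorem allm_true : allm 13 0 = true := by decide +kernel

theorem chk_all (m : ℕ) (hm : m < 2 ^ 13) : chk m = true :=
  allm_spec 13 0 allm_true m (Nat.div_eq_of_lt hm)

theorem tl_blk : (tl.all fun t => tab.all fun l => !(Nat.beq (Nat.land t l) 0)) = true := by
  decide +kernel

theorem tl_inj : (tl.all fun t => (List.finRange 13).all fun x => (List.finRange 13).all fun y =>
    !(Nat.beq (Nat.land t (mk x)) (Nat.land t (mk y))) || Nat.beq x.val y.val) = true := by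
  decide +kernel

theorem mk_mem : ∀ j, mk j ∈ tab := by decide +kernel
theorem mem_mk : ∀ l ∈ tab, ∃ j, l = mk j := by decide +kernel
theorem mk_lt : ∀ j, mk j < 2 ^ 13 := by decide +kernel

theorem tb_land (a b i : ℕ) : (Nat.land a b).testBit i = (a.testBit i && b.testBit i) :=
  Nat.testBit_and a b i
theorem tb_xor (a b i : ℕ) : (Nat.xor a b).testBit i = (a.testBit i ^^ b.testBit i) :=
  Nat.testBit_xor a b i

theorem land_mk_eq {t : ℕ} {x y : Fin 13}
    (h : ∀ i : Fin 13, t.testBit i.val = true → (I i x = true ↔ I i y = true)) :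
    Nat.land t (mk x) = Nat.land t (mk y) := by
  apply Nat.eq_of_testBit_eq
  intro i
  rw [tb_land, tb_land]
  by_cases hi : i < 13
  · have := h ⟨i, hi⟩
    simp only [I] at this
    revert this
    cases t.testBit i <;> cases (mk x).testBit i <;> cases (mk y).testBit i <;> simp
  · have hp : 2 ^ 13 ≤ 2 ^ i := Nat.pow_le_pow_right (by norm_num) (by omega)
    rw [Nat.testBit_lt_two_pow ((mk_lt x).trans_le hp), Nat.testBit_lt_two_pow ((mk_lt y).trans_le hp)]

theorem land_mk_ne {t : ℕ} {x : Fin 13} (h : Nat.land t (mk x) ≠ 0) :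
    ∃ i : Fin 13, t.testBit i.val = true ∧ I i x = true := by
  obtain ⟨i, hi⟩ := Nat.exists_testBit_of_ne_zero h
  rw [tb_land, Bool.and_eq_true] at hi
  have hlt : i < 13 := by
    by_contra hc
    have hp : 2 ^ 13 ≤ 2 ^ i := Nat.pow_le_pow_right (by norm_num) (by omega)
    rw [Nat.testBit_lt_two_pow ((mk_lt x).trans_le hp)] at hi
    simp at hi
  exact ⟨⟨i, hlt⟩, hi⟩

/-- every blocking set contains a vertexless triangle, with the needed properties -/
theorem key (b : Fin 13 → Bool)
    (h1 : ∀ L, ∃ i, b i = true ∧ I i L = true) (h2 : ∀ L, ∃ i, I i L = true ∧ ¬ b i = true) :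
    ∃ c : Fin 13 → Bool, (∀ i, c i = true → b i = true) ∧ (∀ L, ∃ i, c i = true ∧ I i L = true) ∧
      (∀ L M, (∀ i, c i = true → (I i L = true ↔ I i M = true)) → L = M) ∧
      ∃ x y z : Fin 13, (¬ ∃ i, I i x = true ∧ I i y = true ∧ I i z = true) ∧
        ∀ i, c i = true ↔
      ((I i x = true ∧ ¬ I i y = true ∧ ¬ I i z = true) ∨
       (¬ I i x = true ∧ I i y = true ∧ ¬ I i z = true) ∨
       (¬ I i x = true ∧ ¬ I i y = true ∧ I i z = true)) := by
  have e : ∀ i : Fin 13, Nat.testBit (Nat.ofBits b) i.val = b i := by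
    intro i
    simp [Nat.testBit_ofBits_lt]
  have hc := chk_all (Nat.ofBits b) (Nat.ofBits_lt_two_pow b)
  rw [chk, Bool.or_eq_true, List.any_eq_true, List.any_eq_true] at hc
  rcases hc with ⟨l, hl, hc⟩ | ⟨t, ht, hc⟩
  · exfalso
    obtain ⟨j, rfl⟩ := mem_mk l hl
    rw [Bool.or_eq_true, Nat.beq_eq, Nat.beq_eq] at hc
    rcases hc with hc | hc
    · obtain ⟨i, hi, hI⟩ := h1 j
      have := congrArg (fun n => Nat.testBit n i.val) hc
      simp only [tb_land, e, hi] at this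
      rw [I] at hI
      simp [hI] at this
    · obtain ⟨i, hI, hi⟩ := h2 j
      have := congrArg (fun n => Nat.testBit n i.val) hc
      simp only [tb_land, e] at this
      rw [I] at hI
      simp [hI] at this
      exact hi this
  · rw [Nat.beq_eq] at hc
    refine ⟨fun i => t.testBit i.val, ?_, ?_, ?_, ?_⟩
    · intro i hi
      have := congrArg (fun n => Nat.testBit n i.val) hc
      simp only [tb_land, e, hi] at this
      simpa using this
    · intro L
      have := List.all_eq_true.1 (List.all_eq_true.1 tl_blk t ht) _ (mk_mem L)
      apply land_mk_ne
      intro h0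
      rw [h0] at this
      simp at this
    · intro L M h
      have := List.all_eq_true.1 (List.all_eq_true.1 (List.all_eq_true.1 tl_inj t ht) L
        (List.mem_finRange L)) M (List.mem_finRange M)
      rw [land_mk_eq h] at this
      apply Fin.ext
      simpa using this
    · rw [triT_eq] at ht
      simp only [triT, List.mem_flatMap, List.mem_map, List.mem_filter, Bool.and_eq_true,
        Nat.beq_eq] at ht
      obtain ⟨x, -, y, -, z, ⟨-, -, h0⟩, rfl⟩ := ht
      have hn : ∀ i, ¬ (I i x = true ∧ I i y = true ∧ I i z = true) := by
        rintro i ⟨a1, a2, a3⟩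
        have := congrArg (fun n => Nat.testBit n i.val) h0
        simp only [tb_land] at this
        rw [I] at a1 a2 a3
        simp [a1, a2, a3] at this
      refine ⟨x, y, z, not_exists.2 hn, ?_⟩
      intro i
      have := hn i
      simp only [tb_xor, I] at this ⊢
      revert this
      cases (mk x).testBit i.val <;> cases (mk y).testBit i.val <;> cases (mk z).testBit i.val <;> simp

def dotf (w : Fin 3 → F) : (Fin 3 → F) →ₗ[F] F :=
  w 0 • LinearMap.proj 0 + w 1 • LinearMap.proj 1 + w 2 • LinearMap.proj 2

theorem dotf_apply (w x : Fin 3 → F) : dotf w x = w 0 * x 0 + w 1 * x 1 + w 2 * x 2 := by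
  simp [dotf]

theorem ker_rank (f : (Fin 3 → F) →ₗ[F] F) (hf : f ≠ 0) :
    Module.finrank F (LinearMap.ker f) = 2 := by
  have h1 := f.finrank_range_add_finrank_ker
  have h2 : LinearMap.range f = ⊤ := LinearMap.range_eq_top.2 (LinearMap.surjective hf)
  rw [h2] at h1
  simp at h1
  omega

theorem dotf_ne (w : Fin 3 → F) (hw : w ≠ 0) : dotf w ≠ 0 := by
  intro h
  apply hw
  funext i
  have := LinearMap.congr_fun h (Pi.single i 1)
  rw [dotf_apply] at this
  fin_cases i <;> simpa using this

theorem line_exists (L : Submodule F (Fin 3 → F)) (hL : Module.finrank F L = 2) :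
    ∃ w : Fin 3 → F, w ≠ 0 ∧ L = LinearMap.ker (dotf w) := by
  have hlt : L < ⊤ := by
    rw [lt_top_iff_ne_top]
    rintro rfl
    simp at hL
  obtain ⟨f, hf, hle⟩ := Submodule.exists_le_ker_of_lt_top L hlt
  have hfd : f = dotf (fun i => f (Pi.single i 1)) := by
    apply LinearMap.pi_ext'
    intro i
    ext
    simp only [LinearMap.comp_apply, dotf_apply]
    fin_cases i <;> simp
  refine ⟨fun i => f (Pi.single i 1), ?_, ?_⟩
  · intro h
    apply hf
    rw [hfd, h]
    ext
    simp [dotf_apply]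
  · rw [← hfd]
    exact Submodule.eq_of_le_of_finrank_eq hle (by rw [hL, ker_rank f hf])

section
variable (e : ZMod 3 ≃+* F)

def vec (i : Fin 13) : Fin 3 → F := fun k => e (tv i k)

theorem vec_ne (i) : vec e i ≠ 0 := by
  intro h
  apply tv_ne i
  funext k
  have := congrFun h k
  simpa [vec] using this

def pt (i : Fin 13) : Pt F := ⟨Submodule.span F {vec e i}, finrank_span_singleton (vec_ne e i)⟩
def ln (i : Fin 13) : Ln F := ⟨LinearMap.ker (dotf (vec e i)), ker_rank _ (dotf_ne _ (vec_ne e i))⟩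

theorem incid_iff (i j) : Incid (pt e i) (ln e j) ↔ I i j = true := by
  rw [I_iff]
  simp only [Incid, pt, ln, Submodule.span_singleton_le_iff_mem, LinearMap.mem_ker, dotf_apply, vec,
    ← map_mul, ← map_add]
  exact map_eq_zero_iff e e.injective

theorem vec_surj (v : Fin 3 → F) (hv : v ≠ 0) : ∃ i, ∃ u : F, u ≠ 0 ∧ v = u • vec e i := by
  have h0 : e.symm (v 0) ≠ 0 ∨ e.symm (v 1) ≠ 0 ∨ e.symm (v 2) ≠ 0 := by
    by_contra! h
    apply hv
    funext k
    simp only [map_eq_zero_iff e.symm e.symm.injective] at h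
    fin_cases k
    exacts [h.1, h.2.1, h.2.2]
  obtain ⟨i, u, hu, h1, h2, h3⟩ := tv_surj _ _ _ h0
  refine ⟨i, e u, by simpa using hu, ?_⟩
  rw [RingEquiv.symm_apply_eq] at h1 h2 h3
  funext k
  fin_cases k <;> simp [vec, h1, h2, h3]

theorem pt_surj : Function.Surjective (pt e) := by
  rintro ⟨P, hP⟩
  obtain ⟨v, hv, h⟩ := (finrank_eq_one_iff' (K := F) (V := P)).1 hP
  have hv' : (v : Fin 3 → F) ≠ 0 := by simpa using hv
  obtain ⟨i, u, hu, hvu⟩ := vec_surj e _ hv'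
  refine ⟨i, Subtype.ext ?_⟩
  apply Submodule.eq_of_le_of_finrank_eq
  · simp only [pt, Submodule.span_singleton_le_iff_mem]
    have : vec e i = u⁻¹ • (v : Fin 3 → F) := by rw [hvu, smul_smul, inv_mul_cancel₀ hu, one_smul]
    rw [this]
    exact P.smul_mem _ v.2
  · exact (pt e i).2.trans hP.symm

theorem ln_surj : Function.Surjective (ln e) := by
  rintro ⟨L, hL⟩
  obtain ⟨w, hw, rfl⟩ := line_exists L hL
  obtain ⟨i, u, hu, rfl⟩ := vec_surj e _ hw
  refine ⟨i, Subtype.ext ?_⟩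
  ext x
  have : dotf (u • vec e i) x = u * dotf (vec e i) x := by
    simp only [dotf_apply, Pi.smul_apply, smul_eq_mul]; ring
  simp [ln, this, hu]

theorem pt_inj : Function.Injective (pt e) := by
  intro i j h
  apply I_inj1
  intro k
  rw [Bool.eq_iff_iff, ← incid_iff e, ← incid_iff e, h]

theorem ln_inj : Function.Injective (ln e) := by
  intro i j h
  apply I_inj2
  intro k
  rw [Bool.eq_iff_iff, ← incid_iff e, ← incid_iff e, h]

end

theorem main (e : ZMod 3 ≃+* F) (B : Set (Pt F)) (hB : IsMinimalBlocking B) :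
    (∃ a b c : Ln F, NonConcurrent a b c ∧ B = VertexlessTriangle a b c) ∧
    ∀ P ∈ B, HasRInftyAt B P := by
  classical
  have hp := pt_surj e
  have hl := ln_surj e
  have hmin : ∀ P ∈ B, ∃ L : Ln F, ∀ Q, Q ∈ B → Incid Q L → Q = P := by
    intro P hP
    by_contra! hcon
    refine hB.2 (B \ {P}) ?_ ⟨?_, ?_⟩
    · exact ⟨Set.diff_subset, fun h => (h hP).2 rfl⟩
    · intro L
      obtain ⟨Q, h1, h2, h3⟩ := hcon L
      exact ⟨Q, ⟨h1, h3⟩, h2⟩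
    · intro L
      obtain ⟨Q, h1, h2⟩ := hB.1.2 L
      exact ⟨Q, h1, fun h => h2 h.1⟩
  have h1 := hB.1.1
  have h2 := hB.1.2
  simp only [hp.exists, hl.forall, incid_iff] at h1 h2
  obtain ⟨c, hcb, hcl, hci, x, y, z, hn, ht⟩ := key (fun i => decide (pt e i ∈ B))
    (by simpa using h1) (by simpa using h2)
  simp only [decide_eq_true_eq] at hcb
  have hBc : ∀ i, pt e i ∈ B ↔ c i = true := by
    by_contra! hcon
    obtain ⟨i, hi⟩ := hcon
    have hi' : pt e i ∈ B ∧ ¬ c i = true := by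
      have := hcb i
      tauto
    refine hB.2 {P | ∃ i, c i = true ∧ pt e i = P} ⟨?_, ?_⟩ ⟨?_, ?_⟩
    · rintro P ⟨j, hj, rfl⟩
      exact hcb j hj
    · intro hs
      obtain ⟨j, hj, hji⟩ := hs hi'.1
      rw [pt_inj e hji] at hj
      exact hi'.2 hj
    · intro L
      obtain ⟨l, rfl⟩ := hl L
      obtain ⟨j, hj, hI⟩ := hcl l
      exact ⟨pt e j, ⟨j, hj, rfl⟩, (incid_iff e j l).2 hI⟩
    · intro L
      obtain ⟨P, hP, hPB⟩ := hB.1.2 L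
      refine ⟨P, hP, ?_⟩
      rintro ⟨j, hj, rfl⟩
      exact hPB (hcb j hj)
  constructor
  · refine ⟨ln e x, ln e y, ln e z, ?_, ?_⟩
    · simpa only [NonConcurrent, hp.exists, incid_iff] using hn
    · ext P
      obtain ⟨i, rfl⟩ := hp P
      simp only [VertexlessTriangle, Set.mem_setOf_eq, incid_iff]
      exact (hBc i).trans (ht i)
  · intro P hP
    obtain ⟨r, hr⟩ := hmin P hP
    obtain ⟨Q, hQ, hQr⟩ := hB.1.1 r
    obtain rfl := hr Q hQ hQr
    refine ⟨r, hQr, ⟨Q, ⟨hQ, hQr⟩, fun R hR => hr R hR.1 hR.2⟩, ?_⟩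
    intro L hL hLr
    by_contra hns
    apply hLr
    have hL' : ∀ R, R ∈ B → Incid R L → R = Q := by
      intro R hR hRL
      by_contra hne
      exact hns ⟨R, Q, hne, hR, hQ, hRL, hL⟩
    obtain ⟨r, rfl⟩ := hl r
    obtain ⟨L, rfl⟩ := hl L
    congr 1
    apply hci
    intro i hi
    rw [← incid_iff e, ← incid_iff e]
    constructor
    · intro h
      rw [hL' _ ((hBc i).2 hi) h]
      exact hQr
    · intro h
      rw [hr _ ((hBc i).2 hi) h]
      exact hL

end PG23

/-- In PG(2,3), every minimal blocking set is a vertexless triangle, and hence has the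
r∞-property with respect to every one of its points. -/
theorem minimalBlocking_PG23_is_vertexlessTriangle
    (F : Type) [Field F] [Fintype F] (hq : Fintype.card F = 3)
    (B : Set (Pt F)) (hB : IsMinimalBlocking B) :
    (∃ a b c : Ln F, NonConcurrent a b c ∧ B = VertexlessTriangle a b c) ∧
    ∀ P ∈ B, HasRInftyAt B P := by
  have : Fact (Nat.Prime 3) := ⟨Nat.prime_three⟩
  exact PG23.main (ZMod.ringEquivOfPrime F Nat.prime_three hq) B hB
end

section
/- Let q ≥ 5 be a prime power and let 𝓑 be a minimal blocking set of PG(2,q) built with a k-construction with 2q ≤ k ≤ 3q−5 (equivalently, with 2 ≤ n ≤ q−3 chosen points D_i). Then 𝓑 has the r∞-property with respect to some point P ∈ 𝓑 (indeed with respect to every point of 𝓑 lying on the line c), and 𝓑 is not a blocking semioval. -/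
variable {F : Type} [Field F]

structure KConstruction (F : Type) [Field F] (n : ℕ) : Type where
  a : Ln F
  b : Ln F
  c : Ln F
  noncon : NonConcurrent a b c
  PA : Pt F
  PB : Pt F
  PC : Pt F
  hPA : Incid PA b ∧ Incid PA c
  hPB : Incid PB a ∧ Incid PB c
  hPC : Incid PC a ∧ Incid PC b
  el : Ln F
  hel : Incid PA el ∧ el ≠ b ∧ el ≠ c
  A' : Pt F
  hA' : Incid A' el ∧ Incid A' a
  D : Fin n → Pt F
  hD_inj : Function.Injective D
  hD : ∀ i, Incid (D i) el ∧ ¬ Incid (D i) a ∧ ¬ Incid (D i) b ∧ ¬ Incid (D i) c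
  Bp : Fin n → Pt F
  Cp : Fin n → Pt F
  hBp : ∀ i, Incid (Bp i) b ∧ ∃ m : Ln F, Incid PB m ∧ Incid (D i) m ∧ Incid (Bp i) m
  hCp : ∀ i, Incid (Cp i) c ∧ ∃ m : Ln F, Incid PC m ∧ Incid (D i) m ∧ Incid (Cp i) m

def KConstruction.pts {F : Type} [Field F] {n : ℕ} (K : KConstruction F n) : Set (Pt F) :=
  (VertexlessTriangle K.a K.b K.c ∪ Set.range K.D) \ (Set.range K.Bp ∪ Set.range K.Cp)

theorem inc_uniq {F : Type} [Field F] {P Q : Pt F} {L M : Ln F} (h : P ≠ Q)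
    (h1 : Incid P L) (h2 : Incid Q L) (h3 : Incid P M) (h4 : Incid Q M) : L = M := by
  have key : ∀ N : Ln F, Incid P N → Incid Q N → P.1 ⊔ Q.1 = N.1 := by
    intro N hp hq
    apply Submodule.eq_of_le_of_finrank_le (sup_le hp hq)
    rw [N.2]
    by_contra hlt
    have hle : Module.finrank F ↥(P.1 ⊔ Q.1) ≤ 1 := by omega
    have e1 : P.1 = P.1 ⊔ Q.1 := Submodule.eq_of_le_of_finrank_le le_sup_left (by rw [P.2]; exact hle)
    have e2 : Q.1 = P.1 ⊔ Q.1 := Submodule.eq_of_le_of_finrank_le le_sup_right (by rw [Q.2]; exact hle)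
    exact h (Subtype.ext (e1.trans e2.symm))
  exact Subtype.ext ((key L h1 h2).symm.trans (key M h3 h4))

theorem inc_join {F : Type} [Field F] {P Q : Pt F} (h : P ≠ Q) :
    ∃ L : Ln F, Incid P L ∧ Incid Q L := by
  refine ⟨⟨P.1 ⊔ Q.1, ?_⟩, le_sup_left, le_sup_right⟩
  have h0 := Submodule.finrank_sup_add_finrank_inf_eq P.1 Q.1
  rw [P.2, Q.2] at h0
  by_contra hlt
  by_cases hi : Module.finrank F ↥(P.1 ⊓ Q.1) = 0
  · omega
  have e1 : P.1 ⊓ Q.1 = P.1 := Submodule.eq_of_le_of_finrank_le inf_le_left (by rw [P.2]; omega)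
  have e2 : P.1 ⊓ Q.1 = Q.1 := Submodule.eq_of_le_of_finrank_le inf_le_right (by rw [Q.2]; omega)
  exact h (Subtype.ext (e1.symm.trans e2))

theorem inc_meet {F : Type} [Field F] (L M : Ln F) :
    ∃ P : Pt F, Incid P L ∧ Incid P M := by
  have h0 := Submodule.finrank_sup_add_finrank_inf_eq L.1 M.1
  rw [L.2, M.2] at h0
  have h1 := Submodule.finrank_le (L.1 ⊔ M.1)
  rw [Module.finrank_fin_fun] at h1
  have hne : L.1 ⊓ M.1 ≠ ⊥ := by
    intro h
    rw [h, finrank_bot] at h0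
    omega
  obtain ⟨v, hv, hv0⟩ := Submodule.exists_mem_ne_zero_of_ne_bot hne
  refine ⟨⟨Submodule.span F {v}, finrank_span_singleton hv0⟩, ?_, ?_⟩
  · exact (Submodule.span_singleton_le_iff_mem _ _).2 hv.1
  · exact (Submodule.span_singleton_le_iff_mem _ _).2 hv.2

theorem inc_count {F : Type} [Field F] [Fintype F] {P Q : Pt F} {L : Ln F} (h : P ≠ Q)
    (hP : Incid P L) (hQ : Incid Q L) (S : Set (Pt F)) (hf : S.Finite)
    (hS : S.ncard < Fintype.card F - 1) :
    ∃ R : Pt F, Incid R L ∧ R ≠ P ∧ R ≠ Q ∧ R ∉ S := by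
  classical
  obtain ⟨u, hu0, hu⟩ := finrank_eq_one_iff'.1 P.2
  obtain ⟨v, hv0, hv⟩ := finrank_eq_one_iff'.1 Q.2
  have hPu : P.1 = Submodule.span F {(u : Fin 3 → F)} := by
    apply le_antisymm
    · intro w hw
      obtain ⟨c, hc⟩ := hu ⟨w, hw⟩
      exact Submodule.mem_span_singleton.2 ⟨c, congrArg Subtype.val hc⟩
    · exact (Submodule.span_singleton_le_iff_mem _ _).2 u.2
  have hQv : Q.1 = Submodule.span F {(v : Fin 3 → F)} := by
    apply le_antisymm
    · intro w hw
      obtain ⟨c, hc⟩ := hv ⟨w, hw⟩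
      exact Submodule.mem_span_singleton.2 ⟨c, congrArg Subtype.val hc⟩
    · exact (Submodule.span_singleton_le_iff_mem _ _).2 v.2
  have hu1 : (u : Fin 3 → F) ≠ 0 := fun h => hu0 (Subtype.ext h)
  have hv1 : (v : Fin 3 → F) ≠ 0 := fun h => hv0 (Subtype.ext h)
  have hli : LinearIndependent F ![(u : Fin 3 → F), (v : Fin 3 → F)] := by
    rw [LinearIndependent.pair_iff' hu1]
    intro c hc
    apply h
    apply Subtype.ext
    symm
    apply Submodule.eq_of_le_of_finrank_le
    · rw [hQv, Submodule.span_singleton_le_iff_mem, ← hc]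
      exact P.1.smul_mem c u.2
    · rw [P.2, Q.2]
  rw [LinearIndependent.pair_iff] at hli
  have hne : ∀ t : F, (u : Fin 3 → F) + t • (v : Fin 3 → F) ≠ 0 := by
    intro t ht
    have := (hli 1 t (by simpa using ht)).1
    exact one_ne_zero this
  let f : F → Pt F := fun t =>
    ⟨Submodule.span F {(u : Fin 3 → F) + t • (v : Fin 3 → F)}, finrank_span_singleton (hne t)⟩
  have hmem : ∀ t, (u : Fin 3 → F) + t • (v : Fin 3 → F) ∈ (f t).1 :=
    fun t => Submodule.mem_span_singleton_self _
  have hinj : Function.Injective f := by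
    intro s t hst
    have h1 := hmem s
    rw [hst] at h1
    obtain ⟨c, hc⟩ := Submodule.mem_span_singleton.1 h1
    have := hli (c - 1) (c * t - s) (by
      rw [sub_smul, sub_smul, mul_smul, one_smul]
      rw [smul_add] at hc
      linear_combination (exp := 1) hc)
    have hc1 : c = 1 := sub_eq_zero.1 this.1
    have h2 := sub_eq_zero.1 this.2
    rw [hc1, one_mul] at h2
    exact h2.symm
  have hex : ∃ R ∈ f '' {t | t ≠ 0}, R ∉ S := by
    apply Set.exists_mem_notMem_of_ncard_lt_ncard _ hf
    rw [Set.ncard_image_of_injective _ hinj]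
    have : ({t : F | t ≠ 0} : Set F) = ({0} : Set F)ᶜ := rfl
    rw [this, Set.ncard_compl, Set.ncard_singleton, Nat.card_eq_fintype_card]
    exact hS
  obtain ⟨R, ⟨t, ht, rfl⟩, hR⟩ := hex
  refine ⟨f t, ?_, ?_, ?_, hR⟩
  · refine (Submodule.span_singleton_le_iff_mem _ _).2 ?_
    exact L.1.add_mem (hP u.2) (L.1.smul_mem t (hQ v.2))
  · intro e
    have h1 := hmem t
    rw [e] at h1; replace h1 := hPu.le h1
    obtain ⟨c, hc⟩ := Submodule.mem_span_singleton.1 h1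
    have := hli (1 - c) t (by rw [sub_smul, one_smul]; linear_combination (exp := 1) -hc)
    exact ht this.2
  · intro e
    have h1 := hmem t
    rw [e] at h1; replace h1 := hQv.le h1
    obtain ⟨c, hc⟩ := Submodule.mem_span_singleton.1 h1
    have := hli 1 (t - c) (by rw [sub_smul, one_smul]; linear_combination (exp := 1) -hc)
    exact one_ne_zero this.1

/-- A minimal blocking set built with a `k`-construction, `2q ≤ k = 3q-3-n ≤ 3q-5`
(equivalently `2 ≤ n ≤ q-3`), has the r∞-property with respect to some of its points
(indeed with respect to every of its points on the line `c`), and is not a blocking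
semioval. -/
theorem kConstruction_rInfty_not_semioval
    (F : Type) [Field F] [Fintype F] (hq : 5 ≤ Fintype.card F)
    (n : ℕ) (hn1 : 2 ≤ n) (hn2 : n ≤ Fintype.card F - 3)
    (K : KConstruction F n) (hmin : IsMinimalBlocking K.pts) :
    (∃ P ∈ K.pts, HasRInftyAt K.pts P) ∧
    (∀ P ∈ K.pts, Incid P K.c → HasRInftyAt K.pts P) ∧
    ¬ (IsBlocking K.pts ∧ IsSemioval K.pts) := by
  have nc : ∀ P : Pt F, Incid P K.a → Incid P K.b → Incid P K.c → False :=
    fun P h1 h2 h3 => K.noncon ⟨P, h1, h2, h3⟩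
  have uq : ∀ (P Q : Pt F) (L M : Ln F), Incid P L → Incid Q L → Incid P M → Incid Q M →
      P = Q ∨ L = M := by
    intro P Q L M h1 h2 h3 h4
    by_cases h : P = Q
    · exact Or.inl h
    · exact Or.inr (inc_uniq h h1 h2 h3 h4)
  obtain ⟨hAb, hAc⟩ := K.hPA
  obtain ⟨hBa, hBc⟩ := K.hPB
  obtain ⟨hCa, hCb⟩ := K.hPC
  have hAB : K.PA ≠ K.PB := fun e => nc K.PB hBa (e ▸ hAb) hBc
  have hBC : K.PB ≠ K.PC := fun e => nc K.PB hBa (e ▸ hCb) hBc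
  have hCc : ¬ Incid K.PC K.c := nc _ hCa hCb
  have hBb : ¬ Incid K.PB K.b := fun h => nc _ hBa h hBc
  have hAa : ¬ Incid K.PA K.a := fun h => nc _ h hAb hAc
  have hac : K.a ≠ K.c := fun e => hCc (e ▸ hCa)
  have hbc : K.b ≠ K.c := fun e => hCc (e ▸ hCb)
  have hab : K.a ≠ K.b := fun e => hBb (e ▸ hBa)
  have memD : ∀ i, K.D i ∈ K.pts := by
    intro i
    obtain ⟨_, h1, h2, h3⟩ := K.hD i
    refine ⟨Or.inr ⟨i, rfl⟩, ?_⟩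
    rintro (⟨j, hj⟩ | ⟨j, hj⟩)
    · exact h2 (hj ▸ (K.hBp j).1)
    · exact h3 (hj ▸ (K.hCp j).1)
  have mema : ∀ P, Incid P K.a → ¬ Incid P K.b → ¬ Incid P K.c → P ∈ K.pts := by
    intro P h1 h2 h3
    refine ⟨Or.inl (Or.inl ⟨h1, h2, h3⟩), ?_⟩
    rintro (⟨j, hj⟩ | ⟨j, hj⟩)
    · exact h2 (hj ▸ (K.hBp j).1)
    · exact h3 (hj ▸ (K.hCp j).1)
  have memc : ∀ P, Incid P K.c → ¬ Incid P K.a → ¬ Incid P K.b → P ∉ Set.range K.Cp →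
      P ∈ K.pts := by
    intro P h1 h2 h3 h4
    refine ⟨Or.inl (Or.inr (Or.inr ⟨h2, h3, h1⟩)), ?_⟩
    rintro (⟨j, hj⟩ | hj)
    · exact h3 (hj ▸ (K.hBp j).1)
    · exact h4 hj
  have main : ∀ P ∈ K.pts, Incid P K.c → HasRInftyAt K.pts P := by
    intro P hP hPc
    have hPab : ¬ Incid P K.a ∧ ¬ Incid P K.b := by
      rcases hP.1 with (h | h | h) | ⟨i, hi⟩
      · exact absurd hPc h.2.2
      · exact absurd hPc h.2.2
      · exact ⟨h.1, h.2.1⟩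
      · exact absurd (hi ▸ hPc) (K.hD i).2.2.2
    have hPC : ∀ i, K.Cp i ≠ P := fun i hi => hP.2 (Or.inr ⟨i, hi⟩)
    have hne : P ≠ K.PC := fun e => hCc (e ▸ hPc)
    obtain ⟨r, hPr, hCr⟩ := inc_join hne
    have hrc : r ≠ K.c := fun e => hCc (e ▸ hCr)
    have hra : r ≠ K.a := fun e => hPab.1 (e ▸ hPr)
    have hrb : r ≠ K.b := fun e => hPab.2 (e ▸ hPr)
    refine ⟨r, hPr, ⟨P, ⟨hP, hPr⟩, ?_⟩, ?_⟩
    · rintro Q ⟨hQ, hQr⟩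
      rcases hQ.1 with (h | h | h) | ⟨i, rfl⟩
      · rcases uq Q K.PC r K.a hQr hCr h.1 hCa with e | e
        · exact absurd (e ▸ hCb) h.2.1
        · exact absurd e hra
      · rcases uq Q K.PC r K.b hQr hCr h.2.1 hCb with e | e
        · exact absurd (e ▸ hCa) h.1
        · exact absurd e hrb
      · rcases uq Q P r K.c hQr hPr h.2.2 hPc with e | e
        · exact e
        · exact absurd e hrc
      · exfalso
        obtain ⟨hCi, m, h1, h2, h3⟩ := K.hCp i
        rcases uq K.PC (K.D i) m r h1 h2 hCr hQr with e | e
        · exact (K.hD i).2.1 (e ▸ hCa)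
        · subst e
          rcases uq (K.Cp i) P m K.c h3 hPr hCi hPc with e | e
          · exact hPC i e
          · exact hrc e
    · intro L hPL hLr
      by_cases hLc : L = K.c
      · subst hLc
        have hcard : (insert P (Set.range K.Cp)).ncard < Fintype.card F - 1 := by
          have h1 := Set.ncard_insert_le P (Set.range K.Cp)
          have h2 : (Set.range K.Cp).ncard ≤ n := by
            rw [← Set.image_univ]
            refine (Set.ncard_image_le Set.finite_univ).trans ?_
            simp [Set.ncard_univ]
          omega
        obtain ⟨R, hRc, hRA, hRB, hRS⟩ :=
          inc_count hAB hAc hBc _ ((Set.finite_range K.Cp).insert P) hcard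
        refine ⟨P, R, fun e => hRS (Or.inl e.symm), hP, memc R hRc ?_ ?_ ?_, hPL, hRc⟩
        · intro h
          rcases uq R K.PB K.a K.c h hBa hRc hBc with e | e
          · exact hRB e
          · exact hac e
        · intro h
          rcases uq R K.PA K.b K.c h hAb hRc hAc with e | e
          · exact hRA e
          · exact hbc e
        · exact fun h => hRS (Or.inr h)
      · obtain ⟨Q, hQL, hQa⟩ := inc_meet L K.a
        have hPQ : P ≠ Q := fun e => hPab.1 (e ▸ hQa)
        refine ⟨P, Q, hPQ, hP, mema Q hQa ?_ ?_, hPL, hQL⟩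
        · intro h
          rcases uq Q K.PC K.a K.b hQa hCa h hCb with e | e
          · subst e
            exact hLr (inc_uniq hPQ hPL hQL hPr hCr)
          · exact hab e
        · intro h
          exact hLc (inc_uniq hPQ hPL hQL hPc h)
  refine ⟨?_, main, ?_⟩
  · obtain ⟨P, hP, hPc⟩ := hmin.1.1 K.c
    exact ⟨P, hP, main P hP hPc⟩
  · rintro ⟨-, hso⟩
    have i : Fin n := ⟨0, by omega⟩
    obtain ⟨hDl, hDa, hDb, hDc⟩ := K.hD i
    obtain ⟨hBi, m, m1, m2, m3⟩ := K.hBp i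
    obtain ⟨hCi, k, k1, k2, k3⟩ := K.hCp i
    have nm : ∀ N : Ln F, ¬ Incid (K.D i) N → N ≠ m := fun N h e => h (e ▸ m2)
    have nk : ∀ N : Ln F, ¬ Incid (K.D i) N → N ≠ k := fun N h e => h (e ▸ k2)
    have tm : IsTangent K.pts m := by
      refine ⟨K.D i, ⟨memD i, m2⟩, ?_⟩
      rintro Q ⟨hQ, hQm⟩
      rcases hQ.1 with (h | h | h) | ⟨j, rfl⟩
      · rcases uq Q K.PB K.a m h.1 hBa hQm m1 with e | e
        · exact absurd (e ▸ hBc) h.2.2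
        · exact absurd e (nm _ hDa)
      · rcases uq Q (K.Bp i) K.b m h.2.1 hBi hQm m3 with e | e
        · exact absurd (Or.inl ⟨i, e.symm⟩) hQ.2
        · exact absurd e (nm _ hDb)
      · rcases uq Q K.PB K.c m h.2.2 hBc hQm m1 with e | e
        · exact absurd (e ▸ hBa) h.1
        · exact absurd e (nm _ hDc)
      · rcases uq (K.D j) (K.D i) K.el m (K.hD j).1 hDl hQm m2 with e | e
        · exact e
        · exact absurd (inc_uniq hAB K.hel.1 (e ▸ m1) hAc hBc) K.hel.2.2
    have hAC : K.PA ≠ K.PC := fun e => hAa (e ▸ hCa)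
    have tk : IsTangent K.pts k := by
      refine ⟨K.D i, ⟨memD i, k2⟩, ?_⟩
      rintro Q ⟨hQ, hQm⟩
      rcases hQ.1 with (h | h | h) | ⟨j, rfl⟩
      · rcases uq Q K.PC K.a k h.1 hCa hQm k1 with e | e
        · exact absurd (e ▸ hCb) h.2.1
        · exact absurd e (nk _ hDa)
      · rcases uq Q K.PC K.b k h.2.1 hCb hQm k1 with e | e
        · exact absurd (e ▸ hCa) h.1
        · exact absurd e (nk _ hDb)
      · rcases uq Q (K.Cp i) K.c k h.2.2 hCi hQm k3 with e | e
        · exact absurd (Or.inr ⟨i, e.symm⟩) hQ.2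
        · exact absurd e (nk _ hDc)
      · rcases uq (K.D j) (K.D i) K.el k (K.hD j).1 hDl hQm k2 with e | e
        · exact e
        · exact absurd (inc_uniq hAC K.hel.1 (e ▸ k1) hAb hCb) K.hel.2.1
    have hmk : m = k := (hso (K.D i) (memD i)).unique ⟨m2, tm⟩ ⟨k2, tk⟩
    subst hmk
    exact nm _ hDa (inc_uniq hBC hBa hCa m1 k1)
end

section
/- Let q ≥ 4 be a prime power and let 𝓑 be a minimal blocking set of PG(2,q) built with a (2q−1)-construction, i.e. n = q−2, so that 𝓑 = (a \ {B,C}) ∪ (ℓ \ {A, A', T}) ∪ {X, Y}, where T is the one point of ℓ \ {A, A'} not among the chosen D_i, X = (BT)∩b and Y = (CT)∩c. Then through every point of 𝓑 there pass at least two tangent lines to 𝓑; in particular, 𝓑 does not have the r∞-property with respect to any point P ∈ 𝓑. -/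
variable {F : Type} [Field F]

abbrev VE (F : Type) [Field F] : Type := (Fin 3 → F) ≃ₗ[F] (Fin 3 → F)

def KRep (E : VE F) (P : Pt F) (x y z : F) : Prop :=
  P.1 = Submodule.span F {E ![x, y, z]}

lemma vec_smul (E : VE F) (c x y z : F) : E ![c * x, c * y, c * z] = c • E ![x, y, z] := by
  rw [← map_smul]; congr 1; ext i; fin_cases i <;> simp

lemma vec_inj (E : VE F) {x y z x' y' z' : F} (h : E ![x, y, z] = E ![x', y', z']) :
    x = x' ∧ y = y' ∧ z = z' := by
  have h1 := E.injective h
  exact ⟨by simpa using congrFun h1 0, by simpa using congrFun h1 1, by simpa using congrFun h1 2⟩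

lemma vec_surj (E : VE F) (p : Fin 3 → F) : ∃ x y z : F, p = E ![x, y, z] := by
  refine ⟨E.symm p 0, E.symm p 1, E.symm p 2, ?_⟩
  rw [← LinearEquiv.symm_apply_eq]
  ext i; fin_cases i <;> simp

lemma rep_exists (E : VE F) (P : Pt F) : ∃ x y z, KRep E P x y z := by
  obtain ⟨v, hv, h⟩ := finrank_eq_one_iff'.1 P.2
  obtain ⟨x, y, z, hx⟩ := vec_surj E v.1
  refine ⟨x, y, z, ?_⟩
  unfold KRep
  rw [← hx]
  apply le_antisymm
  · intro p hp
    obtain ⟨c, hc⟩ := h ⟨p, hp⟩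
    rw [Submodule.mem_span_singleton]
    exact ⟨c, congrArg Subtype.val hc⟩
  · rw [Submodule.span_singleton_le_iff_mem]
    exact v.2

lemma rep_ne (E : VE F) {P : Pt F} {x y z : F} (h : KRep E P x y z) : x ≠ 0 ∨ y ≠ 0 ∨ z ≠ 0 := by
  by_contra! hc
  obtain ⟨rfl, rfl, rfl⟩ := hc
  have h0 : E ![0, 0, 0] = 0 := by
    have := vec_smul E 0 0 0 0
    simpa using this
  have := P.2
  unfold KRep at h
  rw [h0, Submodule.span_zero_singleton] at h
  rw [h] at this
  simp at this

lemma rep_incid (E : VE F) {P : Pt F} {x y z : F} (h : KRep E P x y z) (L : Ln F) :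
    Incid P L ↔ E ![x, y, z] ∈ L.1 := by
  unfold Incid
  rw [h, Submodule.span_singleton_le_iff_mem]

lemma rep_eq (E : VE F) {P Q : Pt F} {x y z x' y' z' : F} (h : KRep E P x y z)
    (h' : KRep E Q x' y' z') : Q = P ↔ ∃ c, c ≠ 0 ∧ x' = c * x ∧ y' = c * y ∧ z' = c * z := by
  constructor
  · intro e
    subst e
    have : E ![x', y', z'] ∈ Submodule.span F {E ![x, y, z]} := by
      rw [← h, h']; exact Submodule.mem_span_singleton_self _
    obtain ⟨c, hc⟩ := Submodule.mem_span_singleton.1 this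
    rw [← vec_smul] at hc
    obtain ⟨h1, h2, h3⟩ := vec_inj E hc
    refine ⟨c, ?_, h1.symm, h2.symm, h3.symm⟩
    rintro rfl
    have := rep_ne E h'
    grind
  · rintro ⟨c, hc, rfl, rfl, rfl⟩
    apply Subtype.ext
    rw [h, h', vec_smul]
    exact Submodule.span_singleton_smul_eq (IsUnit.mk0 c hc) _

lemma line_exists (E : VE F) (α β γ : F) (h : α ≠ 0 ∨ β ≠ 0 ∨ γ ≠ 0) :
    ∃ L : Ln F, ∀ x y z, E ![x, y, z] ∈ L.1 ↔ α * x + β * y + γ * z = 0 := by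
  let φ : (Fin 3 → F) →ₗ[F] F :=
    (α • LinearMap.proj 0 + β • LinearMap.proj 1 + γ • LinearMap.proj 2) ∘ₗ E.symm.toLinearMap
  have hφ : ∀ x y z, φ (E ![x, y, z]) = α * x + β * y + γ * z := by
    intro x y z; simp [φ]
  have hn : φ ≠ 0 := by
    intro h0
    have a1 := hφ 1 0 0
    have a2 := hφ 0 1 0
    have a3 := hφ 0 0 1
    simp [h0] at a1 a2 a3
    grind
  refine ⟨⟨LinearMap.ker φ, ?_⟩, fun x y z => by rw [LinearMap.mem_ker, hφ]⟩
  have h1 := Module.Dual.finrank_ker_add_one_of_ne_zero (f := φ) hn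
  simp at h1
  omega

def KCond (t x y z : F) : Prop :=
  (x = 0 ∧ y ≠ 0 ∧ z ≠ 0) ∨ (y = z ∧ z ≠ 0 ∧ x ≠ 0 ∧ x ≠ t * z) ∨
  (y = 0 ∧ z ≠ 0 ∧ x = t * z) ∨ (z = 0 ∧ y ≠ 0 ∧ x = t * y)

lemma tangent_of (E : VE F) (t : F) (S : Set (Pt F))
    (hS : ∀ P x y z, KRep E P x y z → (P ∈ S ↔ KCond t x y z))
    {P : Pt F} {x y z : F} (hP : KRep E P x y z) (hPS : P ∈ S) (α β γ : F) (L : Ln F)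
    (hL : ∀ x y z, E ![x, y, z] ∈ L.1 ↔ α * x + β * y + γ * z = 0)
    (h0 : α * x + β * y + γ * z = 0)
    (h : ∀ x' y' z', KCond t x' y' z' → α * x' + β * y' + γ * z' = 0 →
      ∃ c, x' = c * x ∧ y' = c * y ∧ z' = c * z) : Incid P L ∧ IsTangent S L := by
  have hi : Incid P L := by rw [rep_incid E hP, hL, h0]
  refine ⟨hi, P, ⟨hPS, hi⟩, ?_⟩
  rintro Q ⟨hQ, hQL⟩
  obtain ⟨x', y', z', hr⟩ := rep_exists E Q
  rw [hS Q _ _ _ hr] at hQ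
  rw [rep_incid E hr, hL] at hQL
  obtain ⟨c, h1, h2, h3⟩ := h _ _ _ hQ hQL
  rw [rep_eq E hP hr]
  refine ⟨c, ?_, h1, h2, h3⟩
  rintro rfl
  have := rep_ne E hr
  simp_all

lemma two_of (E : VE F) (t : F) (S : Set (Pt F))
    (hS : ∀ P x y z, KRep E P x y z → (P ∈ S ↔ KCond t x y z))
    {P : Pt F} {x y z : F} (hP : KRep E P x y z) (hPS : P ∈ S) (α β γ α' β' γ' : F)
    (h0 : α * x + β * y + γ * z = 0)
    (h : ∀ x' y' z', KCond t x' y' z' → α * x' + β * y' + γ * z' = 0 →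
      ∃ c, x' = c * x ∧ y' = c * y ∧ z' = c * z)
    (h0' : α' * x + β' * y + γ' * z = 0)
    (h' : ∀ x' y' z', KCond t x' y' z' → α' * x' + β' * y' + γ' * z' = 0 →
      ∃ c, x' = c * x ∧ y' = c * y ∧ z' = c * z)
    (hn : α ≠ 0 ∨ β ≠ 0 ∨ γ ≠ 0) (hn' : α' ≠ 0 ∨ β' ≠ 0 ∨ γ' ≠ 0)
    (a b c : F) (hd : ¬ (α * a + β * b + γ * c = 0 ↔ α' * a + β' * b + γ' * c = 0)) :
    ∃ m₁ m₂ : Ln F, m₁ ≠ m₂ ∧ Incid P m₁ ∧ Incid P m₂ ∧ IsTangent S m₁ ∧ IsTangent S m₂ := by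
  obtain ⟨L, hL⟩ := line_exists E α β γ hn
  obtain ⟨L', hL'⟩ := line_exists E α' β' γ' hn'
  have t1 := tangent_of E t S hS hP hPS α β γ L hL h0 h
  have t2 := tangent_of E t S hS hP hPS α' β' γ' L' hL' h0' h'
  refine ⟨L, L', ?_, t1.1, t2.1, t1.2, t2.2⟩
  rintro rfl
  exact hd ((hL a b c).symm.trans (hL' a b c))

lemma two_slopes [Fintype F] (hq : 4 ≤ Fintype.card F) (t : F) :
    ∃ s s' : F, s ≠ s' ∧ (s ≠ 0 ∧ s ≠ t ∧ s ≠ -t) ∧ (s' ≠ 0 ∧ s' ≠ t ∧ s' ≠ -t) := by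
  classical
  have key : ({0, t, -t} : Finset F).card + 2 ≤ Fintype.card F := by
    by_cases h4 : Fintype.card F = 4
    · have : (4 : F) = 0 := by
        have := FiniteField.cast_card_eq_zero F
        rw [h4] at this
        exact_mod_cast this
      have h2 : (2 : F) = 0 := by
        have : (2 : F) * 2 = 0 := by linear_combination this
        simpa using this
      have : -t = t := by linear_combination (-t) * h2
      rw [this]
      have : ({0, t, t} : Finset F).card ≤ 2 := by
        simpa using Finset.card_le_two (a := (0 : F)) (b := t)
      omega
    · have := Finset.card_le_three (a := (0 : F)) (b := t) (c := -t)
      omega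
  have hc := Finset.card_compl ({0, t, -t} : Finset F)
  have : 1 < (({0, t, -t} : Finset F)ᶜ).card := by omega
  obtain ⟨s, hs, s', hs', hne⟩ := Finset.one_lt_card.1 this
  simp at hs hs'
  exact ⟨s, s', hne, by tauto, by tauto⟩

lemma core [Fintype F] (hq : 4 ≤ Fintype.card F) (E : VE F) (t : F) (ht : t ≠ 0) (S : Set (Pt F))
    (hS : ∀ P x y z, KRep E P x y z → (P ∈ S ↔ KCond t x y z)) (P : Pt F) (hPS : P ∈ S) :
    ∃ m₁ m₂ : Ln F, m₁ ≠ m₂ ∧ Incid P m₁ ∧ Incid P m₂ ∧ IsTangent S m₁ ∧ IsTangent S m₂ := by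
  obtain ⟨x, y, z, hP⟩ := rep_exists E P
  have hc := (hS _ _ _ _ hP).1 hPS
  rcases hc with ⟨rfl, hy, hz⟩ | ⟨rfl, hz, hx, hx'⟩ | ⟨rfl, hz, rfl⟩ | ⟨rfl, hy, rfl⟩
  · by_cases hyz : y = z
    · subst hyz
      obtain ⟨s, s', hne, ⟨hs0, hs1, hs2⟩, ⟨hs0', hs1', hs2'⟩⟩ := two_slopes hq t⁻¹
      have aux : ∀ s : F, s ≠ 0 → s ≠ t⁻¹ → s ≠ -t⁻¹ → ∀ x' y' z', KCond t x' y' z' → s * x' + (-1) * y' + 1 * z' = 0 →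
        ∃ c, x' = c * 0 ∧ y' = c * y ∧ z' = c * y := by
        intro s h0 h1 h2 x' y' z' h h'
        refine ⟨z' / y, ?_⟩
        have h1 : s * t ≠ 1 := fun h => h1 (eq_inv_of_mul_eq_one_left h)
        have h2 : s * t ≠ -1 := fun h => h2 (by field_simp; exact h)
        rcases h with h | h | h | h <;> grind
      exact two_of E t S hS hP hPS s (-1) 1 s' (-1) 1 (by ring) (aux s hs0 hs1 hs2)
        (by ring) (aux s' hs0' hs1' hs2') (by simp) (by simp) 1 s 0 (by grind)
    · refine two_of E t S hS hP hPS 0 z (-y) (z - y) (-t * z) (t * y) (by ring) ?_ (by ring) ?_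
        (by simp [hz]) (by simp [ht, hz]) 1 0 0 (by grind)
      · intro x' y' z' h h'
        refine ⟨z' / z, ?_⟩
        rcases h with h | h | h | h <;> grind
      · intro x' y' z' h h'
        refine ⟨z' / z, ?_⟩
        rcases h with h | h | h | h <;> grind
  · refine two_of E t S hS hP hPS y 0 (-x) y (-x) 0 (by ring) ?_ (by ring) ?_
        (by simp [hz]) (by simp [hz]) 0 1 0 (by grind)
    · intro x' y' z' h h'
      refine ⟨z' / y, ?_⟩
      rcases h with h | h | h | h <;> grind
    · intro x' y' z' h h'
      refine ⟨y' / y, ?_⟩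
      rcases h with h | h | h | h <;> grind
  · refine two_of E t S hS hP hPS 0 1 0 1 0 (-t) (by ring) ?_ (by ring) ?_
        (by simp) (by simp) 0 1 0 (by grind)
    · intro x' y' z' h h'
      refine ⟨z' / z, ?_⟩
      rcases h with h | h | h | h <;> grind
    · intro x' y' z' h h'
      refine ⟨z' / z, ?_⟩
      rcases h with h | h | h | h <;> grind
  · refine two_of E t S hS hP hPS 0 0 1 1 (-t) 0 (by ring) ?_ (by ring) ?_
        (by simp) (by simp) 0 0 1 (by grind)
    · intro x' y' z' h h'
      refine ⟨y' / y, ?_⟩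
      rcases h with h | h | h | h <;> grind
    · intro x' y' z' h h'
      refine ⟨y' / y, ?_⟩
      rcases h with h | h | h | h <;> grind

lemma pt_vec (P : Pt F) : ∃ v : Fin 3 → F, v ≠ 0 ∧ P.1 = Submodule.span F {v} := by
  obtain ⟨x, y, z, h⟩ := rep_exists (LinearEquiv.refl F _) P
  refine ⟨_, ?_, h⟩
  intro h0
  have := P.2
  unfold KRep at h
  rw [h0, Submodule.span_zero_singleton] at h
  rw [h] at this
  simp at this

lemma ln_eq_of_le {L M : Ln F} (h : L.1 ≤ M.1) : M = L :=
  Subtype.ext (Submodule.eq_of_le_of_finrank_eq h (by rw [L.2, M.2])).symm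

lemma triangle_li (a b c : Ln F) (hn : NonConcurrent a b c) (PA PB PC : Pt F)
    (hA : Incid PA b ∧ Incid PA c) (hB : Incid PB a ∧ Incid PB c) (hC : Incid PC a ∧ Incid PC b)
    (u v w : Fin 3 → F) (hu : PA.1 = Submodule.span F {u}) (hv : PB.1 = Submodule.span F {v})
    (hw : PC.1 = Submodule.span F {w}) : LinearIndependent F ![u, v, w] ∧
    (∀ x y z : F, x • u + y • v + z • w ∈ a.1 ↔ x = 0) ∧
    (∀ x y z : F, x • u + y • v + z • w ∈ b.1 ↔ y = 0) ∧
    (∀ x y z : F, x • u + y • v + z • w ∈ c.1 ↔ z = 0) := by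
  unfold NonConcurrent Incid at *
  have na : u ∉ a.1 := fun h => hn ⟨PA, by rw [hu, Submodule.span_singleton_le_iff_mem]; exact h, hA.1, hA.2⟩
  have nb : v ∉ b.1 := fun h => hn ⟨PB, hB.1, by rw [hv, Submodule.span_singleton_le_iff_mem]; exact h, hB.2⟩
  have nc : w ∉ c.1 := fun h => hn ⟨PC, hC.1, hC.2, by rw [hw, Submodule.span_singleton_le_iff_mem]; exact h⟩
  simp only [hu, hv, hw, Submodule.span_singleton_le_iff_mem] at hA hB hC
  have ia : ∀ x y z : F, x • u + y • v + z • w ∈ a.1 ↔ x = 0 := by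
    intro x y z
    rw [Submodule.add_mem_iff_left _ (Submodule.smul_mem _ _ hC.1),
      Submodule.add_mem_iff_left _ (Submodule.smul_mem _ _ hB.1)]
    constructor
    · intro h; by_contra hx; exact na ((Submodule.smul_mem_iff _ hx).1 h)
    · rintro rfl; simp
  have ib : ∀ x y z : F, x • u + y • v + z • w ∈ b.1 ↔ y = 0 := by
    intro x y z
    rw [Submodule.add_mem_iff_left _ (Submodule.smul_mem _ _ hC.2),
      Submodule.add_mem_iff_right _ (Submodule.smul_mem _ _ hA.1)]
    constructor
    · intro h; by_contra hx; exact nb ((Submodule.smul_mem_iff _ hx).1 h)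
    · rintro rfl; simp
  have ic : ∀ x y z : F, x • u + y • v + z • w ∈ c.1 ↔ z = 0 := by
    intro x y z
    rw [add_assoc, Submodule.add_mem_iff_right _ (Submodule.smul_mem _ _ hA.2),
      Submodule.add_mem_iff_right _ (Submodule.smul_mem _ _ hB.2)]
    constructor
    · intro h; by_contra hx; exact nc ((Submodule.smul_mem_iff _ hx).1 h)
    · rintro rfl; simp
  refine ⟨?_, ia, ib, ic⟩
  rw [Fintype.linearIndependent_iff]
  intro g hg
  simp [Fin.sum_univ_three] at hg
  have h0 := (ia (g 0) (g 1) (g 2)).1 (by rw [hg]; exact zero_mem _)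
  have h1 := (ib (g 0) (g 1) (g 2)).1 (by rw [hg]; exact zero_mem _)
  have h2 := (ic (g 0) (g 1) (g 2)).1 (by rw [hg]; exact zero_mem _)
  intro i; fin_cases i <;> assumption

lemma equiv_of_li (u v w : Fin 3 → F) (h : LinearIndependent F ![u, v, w]) :
    ∃ E : VE F, ∀ x y z, E ![x, y, z] = x • u + y • v + z • w := by
  let B := basisOfLinearIndependentOfCardEqFinrank h (by simp)
  refine ⟨B.equivFun.symm, fun x y z => ?_⟩
  rw [Module.Basis.equivFun_symm_apply]
  simp [Fin.sum_univ_three, B]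

/-- coordinates adapted to the triangle and to `el` -/
lemma frame {n : ℕ} (K : KConstruction F n) : ∃ E : VE F,
    KRep E K.PB 0 1 0 ∧ KRep E K.PC 0 0 1 ∧
    (∀ x y z, E ![x, y, z] ∈ K.a.1 ↔ x = 0) ∧
    (∀ x y z, E ![x, y, z] ∈ K.b.1 ↔ y = 0) ∧
    (∀ x y z, E ![x, y, z] ∈ K.c.1 ↔ z = 0) ∧
    (∀ x y z, E ![x, y, z] ∈ K.el.1 ↔ y = z) := by
  obtain ⟨u, hu0, hu⟩ := pt_vec K.PA
  obtain ⟨v, hv0, hv⟩ := pt_vec K.PB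
  obtain ⟨w, hw0, hw⟩ := pt_vec K.PC
  obtain ⟨li, ia, ib, ic⟩ := triangle_li K.a K.b K.c K.noncon K.PA K.PB K.PC K.hPA K.hPB K.hPC u v w hu hv hw
  obtain ⟨E₀, hE₀⟩ := equiv_of_li u v w li
  have uel : u ∈ K.el.1 := by
    have := K.hel.1
    unfold Incid at this
    rwa [hu, Submodule.span_singleton_le_iff_mem] at this
  have wel : w ∉ K.el.1 := by
    intro h
    apply K.hel.2.1
    apply ln_eq_of_le
    intro p hp
    obtain ⟨x, y, z, rfl⟩ := vec_surj E₀ p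
    rw [hE₀] at hp ⊢
    rw [(ib x y z).1 hp]
    exact add_mem (add_mem (Submodule.smul_mem _ _ uel) (by simp)) (Submodule.smul_mem _ _ h)
  have vel : v ∉ K.el.1 := by
    intro h
    apply K.hel.2.2
    apply ln_eq_of_le
    intro p hp
    obtain ⟨x, y, z, rfl⟩ := vec_surj E₀ p
    rw [hE₀] at hp ⊢
    rw [(ic x y z).1 hp]
    exact add_mem (add_mem (Submodule.smul_mem _ _ uel) (Submodule.smul_mem _ _ h)) (by simp)
  obtain ⟨x, β, γ, hr⟩ := rep_exists E₀ K.A'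
  obtain ⟨h1, h2⟩ := K.hA'
  rw [rep_incid E₀ hr, hE₀] at h1 h2
  have hx := (ia _ _ _).1 h2
  subst hx
  have hne := rep_ne E₀ hr
  have h3 : β • v + γ • w ∈ K.el.1 := by simpa using h1
  have hβ : β ≠ 0 := by
    rintro rfl
    have : γ ≠ 0 := by simpa using hne
    exact wel ((Submodule.smul_mem_iff _ this).1 (by simpa using h3))
  have hγ : γ ≠ 0 := by
    rintro rfl
    exact vel ((Submodule.smul_mem_iff _ hβ).1 (by simpa using h3))
  have hv' : K.PB.1 = Submodule.span F {β • v} := by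
    rw [hv, Submodule.span_singleton_smul_eq (IsUnit.mk0 β hβ)]
  have hw' : K.PC.1 = Submodule.span F {γ • w} := by
    rw [hw, Submodule.span_singleton_smul_eq (IsUnit.mk0 γ hγ)]
  obtain ⟨li', ia', ib', ic'⟩ := triangle_li K.a K.b K.c K.noncon K.PA K.PB K.PC K.hPA K.hPB K.hPC u _ _ hu hv' hw'
  obtain ⟨E, hE⟩ := equiv_of_li _ _ _ li'
  refine ⟨E, ?_, ?_, ?_, ?_, ?_, ?_⟩
  · unfold KRep; rw [hE, hv']; simp
  · unfold KRep; rw [hE, hw']; simp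
  · intro x y z; rw [hE, ia']
  · intro x y z; rw [hE, ib']
  · intro x y z; rw [hE, ic']
  · intro x y z
    rw [hE]
    have : x • u + y • β • v + z • γ • w = (x • u + z • (β • v + γ • w)) + (y - z) • β • v := by
      module
    rw [this, Submodule.add_mem_iff_right _ (add_mem (Submodule.smul_mem _ _ uel) (Submodule.smul_mem _ _ h3))]
    constructor
    · intro h
      by_contra hyz
      exact vel ((Submodule.smul_mem_iff _ hβ).1 ((Submodule.smul_mem_iff _ (sub_ne_zero.2 hyz)).1 h))
    · rintro rfl; simp

lemma vec_lin (E : VE F) (L : Ln F) {x y z x' y' z' : F} (c c' : F) (h : E ![x, y, z] ∈ L.1)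
    (h' : E ![x', y', z'] ∈ L.1) :
    E ![c * x + c' * x', c * y + c' * y', c * z + c' * z'] ∈ L.1 := by
  have : E ![c * x + c' * x', c * y + c' * y', c * z + c' * z'] =
      c • E ![x, y, z] + c' • E ![x', y', z'] := by
    rw [← map_smul, ← map_smul, ← map_add]; congr 1; ext i; fin_cases i <;> simp
  rw [this]
  exact add_mem (Submodule.smul_mem _ _ h) (Submodule.smul_mem _ _ h')

lemma not_all (E : VE F) (L : Ln F) (h1 : E ![1, 0, 0] ∈ L.1) (h2 : E ![0, 1, 0] ∈ L.1)
    (h3 : E ![0, 0, 1] ∈ L.1) : False := by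
  have : L.1 = ⊤ := by
    rw [eq_top_iff]
    intro p _
    obtain ⟨x, y, z, rfl⟩ := vec_surj E p
    have := vec_lin E L 1 z (vec_lin E L x y h1 h2) h3
    simpa using this
  have h := L.2
  rw [this] at h
  simp at h

lemma missing [Fintype F] (hq : 4 ≤ Fintype.card F) (f : Fin (Fintype.card F - 2) → F)
    (hf : Function.Injective f) (h0 : ∀ i, f i ≠ 0) :
    ∃ t : F, t ≠ 0 ∧ ∀ x, (∃ i, f i = x) ↔ x ≠ 0 ∧ x ≠ t := by
  classical
  have h1 : (insert 0 (Finset.univ.image f)).card = Fintype.card F - 1 := by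
    rw [Finset.card_insert_of_notMem (by simpa using h0), Finset.card_image_of_injective _ hf]
    simp; omega
  have h2 : ((insert 0 (Finset.univ.image f))ᶜ).card = 1 := by
    rw [Finset.card_compl, h1]; omega
  obtain ⟨t, ht⟩ := Finset.card_eq_one.1 h2
  have h3 : ∀ x, x = t ↔ (x ≠ 0 ∧ ¬ ∃ i, f i = x) := by
    intro x
    have : x ∈ (insert 0 (Finset.univ.image f))ᶜ ↔ x ∈ ({t} : Finset F) := by rw [ht]
    simp at this
    rw [← this]; simp
  refine ⟨t, ((h3 t).1 rfl).1, fun x => ?_⟩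
  constructor
  · rintro ⟨i, rfl⟩
    exact ⟨h0 i, fun h => ((h3 _).1 h).2 ⟨i, rfl⟩⟩
  · rintro ⟨h, h'⟩
    by_contra hc
    exact h' ((h3 x).2 ⟨h, hc⟩)

lemma main_frame [Fintype F] (hq : 4 ≤ Fintype.card F)
    (K : KConstruction F (Fintype.card F - 2)) : ∃ (E : VE F) (t : F), t ≠ 0 ∧
    ∀ P x y z, KRep E P x y z → (P ∈ K.pts ↔ KCond t x y z) := by
  obtain ⟨E, hB, hC, ia, ib, ic, iel⟩ := frame K
  have hDx : ∀ i, ∃ d, d ≠ 0 ∧ KRep E (K.D i) d 1 1 := by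
    intro i
    obtain ⟨x, y, z, hr⟩ := rep_exists E (K.D i)
    obtain ⟨h1, h2, h3, h4⟩ := K.hD i
    rw [rep_incid E hr] at h1 h2 h3 h4
    rw [iel] at h1; rw [ia] at h2; rw [ib] at h3; rw [ic] at h4
    subst h1
    refine ⟨x / y, div_ne_zero h2 h3, ?_⟩
    unfold KRep at *
    rw [hr]
    have : E ![x, y, y] = y • E ![x / y, 1, 1] := by
      rw [← vec_smul]; congr 2; field_simp
      simp
    rw [this, Submodule.span_singleton_smul_eq (IsUnit.mk0 y h3)]
  choose d hd0 hd using hDx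
  have hdinj : Function.Injective d := by
    intro i j hij
    apply K.hD_inj
    apply Subtype.ext
    rw [hd i, hd j, hij]
  obtain ⟨t, ht, hrange⟩ := missing hq d hdinj hd0
  refine ⟨E, t, ht, ?_⟩
  have hBp : ∀ i, KRep E (K.Bp i) (d i) 0 1 := by
    intro i
    obtain ⟨h1, m, m1, m2, m3⟩ := K.hBp i
    obtain ⟨x, y, z, hr⟩ := rep_exists E (K.Bp i)
    rw [rep_incid E hr, ib] at h1
    rw [rep_incid E hB] at m1
    rw [rep_incid E (hd i)] at m2
    rw [rep_incid E hr] at m3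
    subst h1
    have e1 := vec_lin E m 1 (-1) m2 m1
    have e2 := vec_lin E m 1 (-z) m3 e1
    simp at e1 e2
    have hx : x = d i * z := by
      by_contra hx
      have hx : x - d i * z ≠ 0 := sub_ne_zero.2 hx
      have e3 := vec_lin E m (x - d i * z)⁻¹ 0 e2 e2
      have : (x - d i * z)⁻¹ * (x + -(z * d i)) = 1 := by field_simp; ring
      simp [this] at e3
      have e4 := vec_lin E m 1 (-(d i)) e1 e3
      simp at e4
      exact not_all E m e3 m1 e4
    subst hx
    have hz : z ≠ 0 := by
      rintro rfl
      have := rep_ne E hr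
      simp at this
    unfold KRep at *
    rw [hr]
    have : E ![d i * z, 0, z] = z • E ![d i, 0, 1] := by
      rw [← vec_smul]; simp [mul_comm]
    rw [this, Submodule.span_singleton_smul_eq (IsUnit.mk0 z hz)]
  have hCp : ∀ i, KRep E (K.Cp i) (d i) 1 0 := by
    intro i
    obtain ⟨h1, m, m1, m2, m3⟩ := K.hCp i
    obtain ⟨x, z, y, hr⟩ := rep_exists E (K.Cp i)
    rw [rep_incid E hr, ic] at h1
    rw [rep_incid E hC] at m1
    rw [rep_incid E (hd i)] at m2
    rw [rep_incid E hr] at m3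
    subst h1
    have e1 := vec_lin E m 1 (-1) m2 m1
    have e2 := vec_lin E m 1 (-z) m3 e1
    simp at e1 e2
    have hx : x = d i * z := by
      by_contra hx
      have hx : x - d i * z ≠ 0 := sub_ne_zero.2 hx
      have e3 := vec_lin E m (x - d i * z)⁻¹ 0 e2 e2
      have : (x - d i * z)⁻¹ * (x + -(z * d i)) = 1 := by field_simp; ring
      simp [this] at e3
      have e4 := vec_lin E m 1 (-(d i)) e1 e3
      simp at e4
      exact not_all E m e3 e4 m1
    subst hx
    have hz : z ≠ 0 := by
      rintro rfl
      have := rep_ne E hr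
      simp at this
    unfold KRep at *
    rw [hr]
    have : E ![d i * z, z, 0] = z • E ![d i, 1, 0] := by
      rw [← vec_smul]; simp [mul_comm]
    rw [this, Submodule.span_singleton_smul_eq (IsUnit.mk0 z hz)]
  intro P x y z hP
  have gen : ∀ (Q : Fin (Fintype.card F - 2) → Pt F) (p r : F), (∀ i, KRep E (Q i) (d i) p r) →
      (P ∈ Set.range Q ↔ ∃ c s, c ≠ 0 ∧ s ≠ 0 ∧ s ≠ t ∧ x = c * s ∧ y = c * p ∧ z = c * r) := by
    intro Q p r hQ
    constructor
    · rintro ⟨i, hi⟩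
      obtain ⟨c, hc, h⟩ := (rep_eq E (hQ i) hP).1 hi.symm
      have := (hrange (d i)).1 ⟨i, rfl⟩
      exact ⟨c, d i, hc, this.1, this.2, h⟩
    · rintro ⟨c, s, hc, hs, hs', h⟩
      obtain ⟨i, rfl⟩ := (hrange s).2 ⟨hs, hs'⟩
      exact ⟨i, ((rep_eq E (hQ i) hP).2 ⟨c, hc, h⟩).symm⟩
  have gD : P ∈ Set.range K.D ↔ y = z ∧ z ≠ 0 ∧ x ≠ 0 ∧ x ≠ t * z := by
    rw [gen K.D 1 1 hd]
    constructor
    · rintro ⟨c, s, hc, hs, hs', rfl, rfl, rfl⟩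
      grind
    · rintro ⟨rfl, h1, h2, h3⟩
      exact ⟨y, x / y, h1, div_ne_zero h2 h1, by grind, by field_simp, by simp, by simp⟩
  have gB : P ∈ Set.range K.Bp ↔ y = 0 ∧ z ≠ 0 ∧ x ≠ 0 ∧ x ≠ t * z := by
    rw [gen K.Bp 0 1 hBp]
    constructor
    · rintro ⟨c, s, hc, hs, hs', rfl, rfl, rfl⟩
      grind
    · rintro ⟨rfl, h1, h2, h3⟩
      exact ⟨z, x / z, h1, div_ne_zero h2 h1, by grind, by field_simp, by simp, by simp⟩
  have gC : P ∈ Set.range K.Cp ↔ z = 0 ∧ y ≠ 0 ∧ x ≠ 0 ∧ x ≠ t * y := by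
    rw [gen K.Cp 1 0 hCp]
    constructor
    · rintro ⟨c, s, hc, hs, hs', rfl, rfl, rfl⟩
      grind
    · rintro ⟨rfl, h1, h2, h3⟩
      exact ⟨y, x / y, h1, div_ne_zero h2 h1, by grind, by field_simp, by simp, by simp⟩
  have hne := rep_ne E hP
  unfold KConstruction.pts VertexlessTriangle KCond
  rw [Set.mem_diff, Set.mem_union, Set.mem_union, gD, gB, gC, Set.mem_setOf_eq,
    rep_incid E hP, rep_incid E hP, rep_incid E hP, ia, ib, ic]
  have := mul_ne_zero_iff (a := t) (b := z)
  have := mul_ne_zero_iff (a := t) (b := y)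
  grind

/-- A minimal blocking set built with a `(2q-1)`-construction (i.e. `n = q-2`) has at
least two tangent lines through every one of its points; in particular it does not have
the r∞-property with respect to any of its points. -/
theorem kConstruction_2qm1_two_tangents
    (F : Type) [Field F] [Fintype F] (hq : 4 ≤ Fintype.card F)
    (K : KConstruction F (Fintype.card F - 2)) (hmin : IsMinimalBlocking K.pts) :
    (∀ P ∈ K.pts, ∃ m₁ m₂ : Ln F, m₁ ≠ m₂ ∧ Incid P m₁ ∧ Incid P m₂ ∧
      IsTangent K.pts m₁ ∧ IsTangent K.pts m₂) ∧
    ∀ P ∈ K.pts, ¬ HasRInftyAt K.pts P := by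
  obtain ⟨E, t, ht, hS⟩ := main_frame hq K
  have key := core hq E t ht K.pts hS
  refine ⟨key, ?_⟩
  rintro P hP ⟨r, hr, hrt, hsec⟩
  obtain ⟨m₁, m₂, hne, h1, h2, t1, t2⟩ := key P hP
  have aux : ∀ m, IsTangent K.pts m → IsSecant K.pts m → False := by
    rintro m ⟨Q, _, hQ⟩ ⟨X, Y, hXY, hX, hY, hXm, hYm⟩
    exact hXY ((hQ X ⟨hX, hXm⟩).trans (hQ Y ⟨hY, hYm⟩).symm)
  by_cases h : m₁ = r
  · exact aux m₂ t2 (hsec m₂ h2 (fun h' => hne (h.trans h'.symm)))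
  · exact aux m₁ t1 (hsec m₁ h1 h)
end

section
/- For every prime power q ≥ 5 and every integer k with 2q ≤ k ≤ 3q−5, there exists a minimal blocking set of PG(2,q) of size k which has the r∞-property with respect to some point of it and which is not a blocking semioval. -/
variable {F : Type} [Field F]

theorem vec_ne_iff (a b c : F) : (![a, b, c] : Fin 3 → F) ≠ 0 ↔ ¬ (a = 0 ∧ b = 0 ∧ c = 0) := by
  rw [not_iff_not]
  constructor
  · intro h
    exact ⟨congrFun h 0, congrFun h 1, congrFun h 2⟩
  · rintro ⟨rfl, rfl, rfl⟩
    ext i; fin_cases i <;> rfl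

noncomputable def mkPt (x y z : F) (h : ¬ (x = 0 ∧ y = 0 ∧ z = 0)) : Pt F :=
  ⟨Submodule.span F {![x, y, z]}, finrank_span_singleton ((vec_ne_iff x y z).2 h)⟩

def lnFun (a b c : F) : (Fin 3 → F) →ₗ[F] F :=
  a • LinearMap.proj 0 + b • LinearMap.proj 1 + c • LinearMap.proj 2

theorem lnFun_apply (a b c : F) (v : Fin 3 → F) :
    lnFun a b c v = a * v 0 + b * v 1 + c * v 2 := by
  simp [lnFun]

theorem finrank_ker_of_ne (f : (Fin 3 → F) →ₗ[F] F) (hf : f ≠ 0) :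
    Module.finrank F (LinearMap.ker f) = 2 := by
  have h1 := LinearMap.finrank_range_add_finrank_ker f
  have h2 : LinearMap.range f = ⊤ := LinearMap.range_eq_top.2 (LinearMap.surjective hf)
  rw [h2, finrank_top] at h1
  simp at h1
  omega

theorem lnFun_ne (a b c : F) (h : ¬ (a = 0 ∧ b = 0 ∧ c = 0)) : lnFun a b c ≠ 0 := by
  intro h0
  apply h
  have e := fun v => (lnFun_apply a b c v).symm.trans (by rw [h0]; rfl : lnFun a b c v = 0)
  refine ⟨?_, ?_, ?_⟩
  · simpa using e ![1, 0, 0]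
  · simpa using e ![0, 1, 0]
  · simpa using e ![0, 0, 1]

def mkLn (a b c : F) (h : ¬ (a = 0 ∧ b = 0 ∧ c = 0)) : Ln F :=
  ⟨LinearMap.ker (lnFun a b c), finrank_ker_of_ne _ (lnFun_ne a b c h)⟩

theorem incid_mk (x y z a b c : F) (h h') :
    Incid (mkPt x y z h) (mkLn a b c h') ↔ a * x + b * y + c * z = 0 := by
  unfold Incid mkPt mkLn
  rw [Submodule.span_singleton_le_iff_mem, LinearMap.mem_ker, lnFun_apply]
  simp

theorem exists_mkLn (L : Ln F) : ∃ a b c h, L = mkLn a b c h := by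
  obtain ⟨L, hL⟩ := L
  have hlt : L < ⊤ := by
    rw [lt_top_iff_ne_top]
    rintro rfl
    simp at hL
  obtain ⟨f, hf, hle⟩ := Submodule.exists_le_ker_of_lt_top L hlt
  have hfe : f = lnFun (f ![1, 0, 0]) (f ![0, 1, 0]) (f ![0, 0, 1]) := by
    refine LinearMap.ext fun v => ?_
    rw [lnFun_apply]
    have : v = v 0 • ![1, 0, 0] + v 1 • ![0, 1, 0] + v 2 • ![0, 0, 1] := by
      ext i; fin_cases i <;> simp
    conv_lhs => rw [this]
    simp only [map_add, map_smul, smul_eq_mul]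
    ring
  refine ⟨f ![1, 0, 0], f ![0, 1, 0], f ![0, 0, 1], ?_, ?_⟩
  · rintro ⟨h1, h2, h3⟩
    apply hf
    rw [hfe, h1, h2, h3]
    ext; simp [lnFun]
  · apply Subtype.ext
    change L = LinearMap.ker _
    rw [← hfe]
    exact Submodule.eq_of_le_of_finrank_eq hle (by rw [hL, finrank_ker_of_ne f hf])

theorem mkPt_eq (x y z x' y' z' : F) (h h') (e : mkPt x y z h = mkPt x' y' z' h') :
    ∃ c : F, x = c * x' ∧ y = c * y' ∧ z = c * z' := by
  have e1 : Submodule.span F {![x, y, z]} = Submodule.span F {![x', y', z']} :=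
    congrArg Subtype.val e
  have : ![x, y, z] ∈ Submodule.span F {![x', y', z']} := by
    rw [← e1]; exact Submodule.mem_span_singleton_self _
  obtain ⟨c, hc⟩ := Submodule.mem_span_singleton.1 this
  refine ⟨c, ?_, ?_, ?_⟩
  · simpa using (congrFun hc 0).symm
  · simpa using (congrFun hc 1).symm
  · simpa using (congrFun hc 2).symm

theorem mkLn_scale (a b c t : F) (h h') (ht : t ≠ 0) :
    mkLn (t * a) (t * b) (t * c) h = mkLn a b c h' := by
  apply Subtype.ext
  change LinearMap.ker _ = LinearMap.ker _
  ext v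
  rw [LinearMap.mem_ker, LinearMap.mem_ker, lnFun_apply, lnFun_apply]
  have : t * a * v 0 + t * b * v 1 + t * c * v 2 = t * (a * v 0 + b * v 1 + c * v 2) := by ring
  rw [this]; simp [ht]

noncomputable def aff (x y : F) : Pt F := mkPt x y 1 (by simp)
noncomputable def inft (m : F) : Pt F := mkPt 1 m 0 (by simp)
noncomputable def vinf : Pt F := mkPt 0 1 0 (by simp)

theorem aff_inj {x y x' y' : F} (e : aff x y = aff x' y') : x = x' ∧ y = y' := by
  obtain ⟨c, h1, h2, h3⟩ := mkPt_eq _ _ _ _ _ _ _ _ e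
  have : c = 1 := by simpa using h3.symm
  subst this; rw [one_mul] at h1 h2; exact ⟨h1, h2⟩

theorem inft_inj {x x' : F} (e : inft x = inft x') : x = x' := by
  obtain ⟨c, h1, h2, h3⟩ := mkPt_eq _ _ _ _ _ _ _ _ e
  have : c = 1 := by simpa using h1.symm
  subst this; rwa [one_mul] at h2

theorem aff_ne_inft {x y m : F} : aff x y ≠ inft m := by
  intro e
  obtain ⟨c, h1, h2, h3⟩ := mkPt_eq _ _ _ _ _ _ _ _ e
  simp at h3

theorem vinf_ne_inft {m : F} : (vinf : Pt F) ≠ inft m := by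
  intro e
  obtain ⟨c, h1, h2, h3⟩ := mkPt_eq _ _ _ _ _ _ _ _ e
  simp at h1; subst h1; simp at h2

theorem aff_ne_vinf {x y : F} : aff x y ≠ vinf := by
  intro e
  obtain ⟨c, h1, h2, h3⟩ := mkPt_eq _ _ _ _ _ _ _ _ e
  simp at h3

theorem incid_aff (x y a b c : F) (h) : Incid (aff x y) (mkLn a b c h) ↔ a * x + b * y + c = 0 := by
  unfold aff; rw [incid_mk]; simp

theorem incid_inft (m a b c : F) (h) : Incid (inft m) (mkLn a b c h) ↔ a + b * m = 0 := by
  unfold inft; rw [incid_mk]; simp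

theorem incid_vinf (a b c : F) (h) : Incid vinf (mkLn a b c h) ↔ b = 0 := by
  unfold vinf; rw [incid_mk]; simp

def TT (E : Set F) (x y : F) : Prop :=
  (x = y ∧ x ∈ E) ∨ (y = 0 ∧ x ≠ 0 ∧ x ∉ E) ∨ (x = 0 ∧ y ≠ 0 ∧ y ∉ E)

def BB (E : Set F) : Set (Pt F) :=
  {P | (∃ m, m ≠ 0 ∧ P = inft m) ∨ (∃ x y, TT E x y ∧ P = aff x y)}

theorem inft_mem (E : Set F) (m : F) : inft m ∈ BB E ↔ m ≠ 0 := by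
  constructor
  · rintro (⟨m', h, e⟩ | ⟨x, y, h, e⟩)
    · rwa [inft_inj e]
    · exact absurd e.symm aff_ne_inft
  · exact fun h => Or.inl ⟨m, h, rfl⟩

theorem aff_mem (E : Set F) (x y : F) : aff x y ∈ BB E ↔ TT E x y := by
  constructor
  · rintro (⟨m', h, e⟩ | ⟨x, y, h, e⟩)
    · exact absurd e aff_ne_inft
    · obtain ⟨rfl, rfl⟩ := aff_inj e
      exact h
  · exact fun h => Or.inr ⟨x, y, h, rfl⟩

theorem vinf_not_mem (E : Set F) : vinf ∉ BB E := by
  rintro (⟨m', h, e⟩ | ⟨x, y, h, e⟩)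
  · exact vinf_ne_inft e
  · exact aff_ne_vinf e.symm

theorem tangent_aff (E : Set F) (x y a b c : F) (h) (hT : TT E x y) (hi : a * x + b * y + c = 0)
    (h1 : ∀ m, m ≠ 0 → a + b * m ≠ 0)
    (h2 : ∀ x' y', TT E x' y' → a * x' + b * y' + c = 0 → x' = x ∧ y' = y) :
    IsTangent (BB E) (mkLn a b c h) := by
  refine ⟨aff x y, ⟨(aff_mem E x y).2 hT, (incid_aff ..).2 hi⟩, ?_⟩
  rintro Q ⟨⟨m, hm, rfl⟩ | ⟨x', y', ht, rfl⟩, hQ⟩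
  · exact absurd ((incid_inft ..).1 hQ) (h1 m hm)
  · obtain ⟨rfl, rfl⟩ := h2 x' y' ht ((incid_aff ..).1 hQ)
    rfl

theorem tangent_inft (E : Set F) (m a b c : F) (h) (hm : m ≠ 0) (hi : a + b * m = 0)
    (h1 : ∀ m', m' ≠ 0 → a + b * m' = 0 → m' = m)
    (h2 : ∀ x' y', TT E x' y' → a * x' + b * y' + c ≠ 0) :
    IsTangent (BB E) (mkLn a b c h) := by
  refine ⟨inft m, ⟨(inft_mem E m).2 hm, (incid_inft ..).2 hi⟩, ?_⟩
  rintro Q ⟨⟨m', hm', rfl⟩ | ⟨x', y', ht, rfl⟩, hQ⟩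
  · rw [h1 m' hm' ((incid_inft ..).1 hQ)]
  · exact absurd ((incid_aff ..).1 hQ) (h2 x' y' ht)

/-- vertical tangents -/
theorem tangent_vert (E : Set F) (h0 : (0 : F) ∉ E) (x y : F) (hx : x ≠ 0) (hT : TT E x y) (h) :
    IsTangent (BB E) (mkLn 1 0 (-x) h) := by
  refine tangent_aff E x y _ _ _ h hT (by ring) (by simp) ?_
  intro x' y' hT' e
  have : x' = x := by linear_combination e
  subst this
  refine ⟨rfl, ?_⟩
  unfold TT at hT hT'
  grind

theorem tangent_horiz (E : Set F) (h0 : (0 : F) ∉ E) (x y : F) (hy : y ≠ 0) (hT : TT E x y) (h) :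
    IsTangent (BB E) (mkLn 0 1 (-y) h) := by
  refine tangent_aff E x y _ _ _ h hT (by ring) (by simp) ?_
  intro x' y' hT' e
  have : y' = y := by linear_combination e
  subst this
  refine ⟨?_, rfl⟩
  unfold TT at hT hT'
  grind

theorem exists_tangent (E : Set F) (h0 : (0 : F) ∉ E) (h1 : (1 : F) ∈ E) (h2 : (-1 : F) ∈ E)
    (P : Pt F) (hP : P ∈ BB E) : ∃ L, Incid P L ∧ IsTangent (BB E) L := by
  rcases hP with ⟨m, hm, rfl⟩ | ⟨x, y, hT, rfl⟩
  · by_cases hm1 : m = 1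
    · subst hm1
      have h : ¬ ((-1 : F) = 0 ∧ (1 : F) = 0 ∧ (-1 : F) = 0) := by simp
      refine ⟨mkLn (-1) 1 (-1) h, (incid_inft ..).2 (by ring),
        tangent_inft E 1 _ _ _ h hm (by ring) ?_ ?_⟩
      · intro m' _ e; linear_combination e
      · rintro x y (⟨rfl, hx⟩ | ⟨rfl, hx, hx'⟩ | ⟨rfl, hx, hx'⟩) e
        · apply one_ne_zero (α := F); linear_combination -e
        · apply hx'
          have : x = -1 := by linear_combination -e
          rwa [this]
        · apply hx'
          have : y = 1 := by linear_combination e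
          rwa [this]
    · have h : ¬ (m = 0 ∧ (-1 : F) = 0 ∧ (0 : F) = 0) := by simp
      refine ⟨mkLn m (-1) 0 h, (incid_inft ..).2 (by ring),
        tangent_inft E m _ _ _ h hm (by ring) ?_ ?_⟩
      · intro m' _ e; linear_combination -e
      · rintro x y (⟨rfl, hx⟩ | ⟨rfl, hx, hx'⟩ | ⟨rfl, hx, hx'⟩) e
        · have : x * (m - 1) = 0 := by linear_combination e
          rcases mul_eq_zero.1 this with h | h
          · rw [h] at hx; exact h0 hx
          · exact hm1 (by linear_combination h)
        · have : m * x = 0 := by linear_combination e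
          simp_all
        · apply hx; linear_combination -e
  · by_cases hx : x = 0
    · have hy : y ≠ 0 := by unfold TT at hT; grind
      exact ⟨mkLn 0 1 (-y) (by simp), (incid_aff ..).2 (by ring), tangent_horiz E h0 x y hy hT _⟩
    · exact ⟨mkLn 1 0 (-x) (by simp), (incid_aff ..).2 (by ring), tangent_vert E h0 x y hx hT _⟩

theorem BB_meets (E : Set F) (a0 : F) (ha : a0 ≠ 0) (ha' : a0 ∉ E) (L : Ln F) :
    ∃ P ∈ BB E, Incid P L := by
  obtain ⟨a, b, c, h, rfl⟩ := exists_mkLn L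
  by_cases hb : b = 0
  · by_cases hA : a = 0
    · exact ⟨inft 1, (inft_mem ..).2 one_ne_zero, (incid_inft ..).2 (by simp [hA, hb])⟩
    · have key : ∀ y, TT E (-c / a) y → ∃ P ∈ BB E, Incid P (mkLn a b c h) := fun y hT =>
        ⟨aff (-c / a) y, (aff_mem ..).2 hT, (incid_aff ..).2 (by subst hb; field_simp; ring)⟩
      by_cases h1 : -c / a ∈ E
      · exact key _ (Or.inl ⟨rfl, h1⟩)
      · by_cases h2 : -c / a = 0
        · exact key a0 (Or.inr (Or.inr ⟨h2, ha, ha'⟩))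
        · exact key 0 (Or.inr (Or.inl ⟨rfl, h2, h1⟩))
  · by_cases hA : a = 0
    · have key : ∀ x, TT E x (-c / b) → ∃ P ∈ BB E, Incid P (mkLn a b c h) := fun x hT =>
        ⟨aff x (-c / b), (aff_mem ..).2 hT, (incid_aff ..).2 (by subst hA; field_simp; ring)⟩
      by_cases h1 : -c / b ∈ E
      · exact key _ (Or.inl ⟨rfl, h1⟩)
      · by_cases h2 : -c / b = 0
        · exact key a0 (Or.inr (Or.inl ⟨h2, ha, ha'⟩))
        · exact key 0 (Or.inr (Or.inr ⟨rfl, h2, h1⟩))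
    · refine ⟨inft (-a / b), (inft_mem ..).2 ?_, (incid_inft ..).2 (by field_simp; ring)⟩
      exact div_ne_zero (neg_ne_zero.2 hA) hb

theorem BB_not_full [Fintype F] (hq : 5 ≤ Fintype.card F) (E : Set F) (h0 : (0 : F) ∉ E)
    (L : Ln F) : ∃ P, Incid P L ∧ P ∉ BB E := by
  classical
  obtain ⟨a, b, c, h, rfl⟩ := exists_mkLn L
  by_cases hb : b = 0
  · exact ⟨vinf, (incid_vinf ..).2 hb, vinf_not_mem E⟩
  by_cases ha : a = 0
  · exact ⟨inft 0, (incid_inft ..).2 (by simp [ha]), fun hm => (inft_mem ..).1 hm rfl⟩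
  by_cases hc : c = 0
  · refine ⟨aff 0 0, (incid_aff ..).2 (by simp [hc]), fun hm => ?_⟩
    have := (aff_mem ..).1 hm
    unfold TT at this
    grind
  obtain ⟨x, hx⟩ : ∃ x, x ∉ ({0, -c / a, -c / (a + b)} : Finset F) := by
    by_contra! hcon
    have h1 : Fintype.card F ≤ ({0, -c / a, -c / (a + b)} : Finset F).card := by
      rw [← Finset.card_univ]
      exact Finset.card_le_card fun x _ => hcon x
    have := Finset.card_le_three (a := (0 : F)) (b := -c / a) (c := -c / (a + b))
    omega
  simp only [Finset.mem_insert, Finset.mem_singleton, not_or] at hx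
  obtain ⟨hx0, hx1, hx2⟩ := hx
  refine ⟨aff x (-(a * x + c) / b), (incid_aff ..).2 (by field_simp; ring), fun hm => ?_⟩
  rcases (aff_mem ..).1 hm with ⟨e, -⟩ | ⟨e, -⟩ | ⟨e, -⟩
  · have e1 : x * (a + b) = -c := by
      rw [eq_div_iff hb] at e; linear_combination e
    apply hx2
    rw [eq_div_iff, e1]
    intro hab
    rw [hab, mul_zero] at e1
    exact hc (by linear_combination e1)
  · apply hx1
    rw [div_eq_zero_iff] at e
    rcases e with e | e
    · rw [eq_div_iff ha]; linear_combination -e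
    · exact absurd e hb
  · exact hx0 e

theorem BB_ncard [Fintype F] (E : Finset F) (h0 : (0 : F) ∉ E) (e : ℕ) (he : E.card = e) 
    (heq : e + 1 ≤ Fintype.card F) :
    (BB (E : Set F)).ncard = 3 * Fintype.card F - 3 - e := by
  classical
  have hA : ((insert 0 E)ᶜ : Finset F).card = Fintype.card F - (e + 1) := by
    rw [Finset.card_compl, Finset.card_insert_of_notMem h0, he]
  have hN : (({0} : Finset F)ᶜ : Finset F).card = Fintype.card F - 1 := by
    rw [Finset.card_compl, Finset.card_singleton]
  have hB : BB (E : Set F) = ↑((({0} : Finset F)ᶜ.image inft) ∪ ((E.image fun x => aff x x) ∪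
      ((((insert 0 E)ᶜ : Finset F).image fun x => aff x 0) ∪
        (((insert 0 E)ᶜ : Finset F).image fun y => aff 0 y)))) := by
    ext P
    simp only [BB, TT, Set.mem_ofPred_eq, Finset.coe_union, Finset.coe_image, Set.mem_union,
      Set.mem_image, Finset.mem_coe, Finset.mem_compl, Finset.mem_insert, Finset.mem_singleton]
    constructor
    · rintro (⟨m, hm, rfl⟩ | ⟨x, y, (⟨rfl, hx⟩ | ⟨rfl, hx, hx'⟩ | ⟨rfl, hx, hx'⟩), rfl⟩)
      · exact Or.inl ⟨m, hm, rfl⟩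
      · exact Or.inr (Or.inl ⟨x, hx, rfl⟩)
      · exact Or.inr (Or.inr (Or.inl ⟨x, by tauto, rfl⟩))
      · exact Or.inr (Or.inr (Or.inr ⟨y, by tauto, rfl⟩))
    · rintro (⟨m, hm, rfl⟩ | ⟨x, hx, rfl⟩ | ⟨x, hx, rfl⟩ | ⟨x, hx, rfl⟩)
      · exact Or.inl ⟨m, hm, rfl⟩
      · exact Or.inr ⟨x, x, Or.inl ⟨rfl, hx⟩, rfl⟩
      · exact Or.inr ⟨x, 0, Or.inr (Or.inl ⟨rfl, by tauto, by tauto⟩), rfl⟩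
      · exact Or.inr ⟨0, x, Or.inr (Or.inr ⟨rfl, by tauto, by tauto⟩), rfl⟩
  rw [hB, Set.ncard_coe_finset, Finset.card_union_of_disjoint, Finset.card_union_of_disjoint,
    Finset.card_union_of_disjoint, Finset.card_image_of_injective, Finset.card_image_of_injective,
    Finset.card_image_of_injective, Finset.card_image_of_injective, hA, hN, he]
  · omega
  · exact fun x y h => (aff_inj h).2
  · exact fun x y h => (aff_inj h).1
  · exact fun x y h => (aff_inj h).1
  · exact fun x y h => inft_inj h
  all_goals
    rw [Finset.disjoint_left]
    intro P h1 h2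
    simp only [Finset.mem_union, Finset.mem_image, Finset.mem_compl, Finset.mem_insert,
      Finset.mem_singleton, not_or] at h1 h2
  · obtain ⟨x, hx, rfl⟩ := h1
    obtain ⟨y, hy, e⟩ := h2
    exact hx.1 (aff_inj e).1.symm
  · obtain ⟨x, hx, rfl⟩ := h1
    rcases h2 with ⟨y, hy, e⟩ | ⟨y, hy, e⟩
    · have := (aff_inj e).2
      subst this
      exact h0 hx
    · have := (aff_inj e).1
      subst this
      exact h0 hx
  · obtain ⟨x, hx, rfl⟩ := h1
    rcases h2 with ⟨y, hy, e⟩ | ⟨y, hy, e⟩ | ⟨y, hy, e⟩ <;> exact aff_ne_inft e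

/-- For every prime power `q ≥ 5` and every `2q ≤ k ≤ 3q-5` there is a minimal blocking
set of PG(2,q) of size `k` having the r∞-property with respect to some of its points
which is not a blocking semioval. -/
theorem exists_minimalBlocking_rInfty_not_semioval
    (F : Type) [Field F] [Fintype F] (hq : 5 ≤ Fintype.card F)
    (k : ℕ) (hk1 : 2 * Fintype.card F ≤ k) (hk2 : k ≤ 3 * Fintype.card F - 5) :
    ∃ B : Set (Pt F), IsMinimalBlocking B ∧ B.ncard = k ∧
      (∃ P ∈ B, HasRInftyAt B P) ∧ ¬ (IsBlocking B ∧ IsSemioval B) := by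
  classical
  obtain ⟨E, hE1, hE2, hEc⟩ : ∃ E : Finset F, {1, -1} ⊆ E ∧ E ⊆ ({0} : Finset F)ᶜ ∧
      E.card = 3 * Fintype.card F - 3 - k := by
    apply Finset.exists_subsuperset_card_eq
    · intro x hx
      simp only [Finset.mem_insert, Finset.mem_singleton] at hx
      rcases hx with rfl | rfl <;> simp
    · have := Finset.card_le_two (a := (1 : F)) (b := -1)
      omega
    · rw [Finset.card_compl, Finset.card_singleton]
      omega
  have h0 : (0 : F) ∉ E := fun h => by simpa using hE2 h
  have h1 : (1 : F) ∈ E := hE1 (by simp)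
  have h2 : (-1 : F) ∈ E := hE1 (by simp)
  have hA : 1 < ((insert 0 E)ᶜ : Finset F).card := by
    rw [Finset.card_compl, Finset.card_insert_of_notMem h0]
    omega
  obtain ⟨a, ha, a', ha', haa⟩ := Finset.one_lt_card.1 hA
  simp only [Finset.mem_compl, Finset.mem_insert, not_or] at ha ha'
  have h0' : (0 : F) ∉ (E : Set F) := by simpa using h0
  have hT : TT (E : Set F) a 0 := Or.inr (Or.inl ⟨rfl, ha.1, by simpa using ha.2⟩)
  have hT' : TT (E : Set F) a' 0 := Or.inr (Or.inl ⟨rfl, ha'.1, by simpa using ha'.2⟩)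
  refine ⟨BB (E : Set F), ⟨⟨BB_meets _ a ha.1 (by simpa using ha.2), BB_not_full hq _ h0'⟩, ?_⟩,
    ?_, ⟨aff a 0, (aff_mem ..).2 hT, mkLn 1 0 (-a) (by simp), (incid_aff ..).2 (by ring),
      tangent_vert _ h0' a 0 ha.1 hT _, ?_⟩, ?_⟩
  · intro B' hB' hbl
    obtain ⟨hsub, P, hP, hPn⟩ := Set.ssubset_iff_exists.1 hB'
    obtain ⟨L, hPL, R, hR, hu⟩ := exists_tangent (E : Set F) h0' (by simpa using h1)
      (by simpa using h2) P hP
    obtain ⟨Q, hQ, hQL⟩ := hbl.1 L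
    have e1 := hu Q ⟨hsub hQ, hQL⟩
    have e2 := hu P ⟨hP, hPL⟩
    rw [e2, ← e1] at hPn
    exact hPn hQ
  · rw [BB_ncard E h0 _ hEc (by omega)]
    omega
  · intro L hL hne
    obtain ⟨u, v, w, h, rfl⟩ := exists_mkLn L
    have hL' := (incid_aff ..).1 hL
    by_cases hu : u = 0
    · refine ⟨aff a 0, aff a' 0, fun e => haa (aff_inj e).1, (aff_mem ..).2 hT,
        (aff_mem ..).2 hT', hL, (incid_aff ..).2 ?_⟩
      subst hu
      linear_combination hL'
    by_cases hv : v = 0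
    · exfalso
      apply hne
      subst hv
      have hw : w = u * (-a) := by linear_combination hL'
      subst hw
      have := mkLn_scale 1 0 (-a) u (by simp [hu]) (by simp) hu
      rw [← this]
      congr 1 <;> simp
    · exact ⟨aff a 0, inft (-u / v), aff_ne_inft, (aff_mem ..).2 hT,
        (inft_mem ..).2 (div_ne_zero (neg_ne_zero.2 hu) hv), hL,
        (incid_inft ..).2 (by field_simp; ring)⟩
  · rintro ⟨-, hS⟩
    have hT1 : TT (E : Set F) 1 1 := Or.inl ⟨rfl, by simpa using h1⟩
    have hu := (hS (aff 1 1) ((aff_mem ..).2 hT1)).unique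
      ⟨(incid_aff 1 1 1 0 (-1) (by simp)).2 (by ring),
        tangent_vert _ h0' 1 1 one_ne_zero hT1 _⟩
      ⟨(incid_aff 1 1 0 1 (-1) (by simp)).2 (by ring),
        tangent_horiz _ h0' 1 1 one_ne_zero hT1 _⟩
    have hi : Incid (aff 1 0) (mkLn (1 : F) 0 (-1) (by simp)) := (incid_aff ..).2 (by ring)
    rw [hu] at hi
    have := (incid_aff ..).1 hi
    simp at this
end

section
/- Let q ≥ 3 be a prime power. Every blocking set 𝓑 of PG(2,q) with |𝓑| ≤ 2q−1 fails the r∞-property with respect to every point P ∈ 𝓑; that is, no blocking set of size at most 2q−1 in PG(2,q) has the r∞-property with respect to any of its points. -/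
variable {F : Type} [Field F]

lemma finrank_ker_two {F : Type} [Field F] (f : (Fin 3 → F) →ₗ[F] F) (v : Fin 3 → F)
    (h : f v ≠ 0) : Module.finrank F ↥(LinearMap.ker f) = 2 := by
  have h1 := LinearMap.finrank_range_add_finrank_ker f
  have h2 : LinearMap.range f = ⊤ :=
    LinearMap.range_eq_top.2 (LinearMap.surjective (by rintro rfl; simp at h))
  rw [h2] at h1
  simp at h1
  omega

lemma pt_gen {F : Type} [Field F] (a : Pt F) : ∃ w : Fin 3 → F, w ≠ 0 ∧ w ∈ a.1 ∧
    ∀ S : Submodule F (Fin 3 → F), w ∈ S → a.1 ≤ S := by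
  obtain ⟨v, hv, h⟩ := finrank_eq_one_iff'.1 a.2
  refine ⟨v.1, by simpa using hv, v.2, fun S hS x hx => ?_⟩
  obtain ⟨c, hc⟩ := h ⟨x, hx⟩
  have : x = c • v.1 := by rw [← Submodule.coe_smul, hc]
  rw [this]
  exact S.smul_mem _ hS

/-- No blocking set of PG(2,q) of size at most `2q-1` has the r∞-property with respect
to any of its points. -/
theorem no_rInfty_of_card_le
    (F : Type) [Field F] [Fintype F] (hq : 3 ≤ Fintype.card F)
    (B : Set (Pt F)) (hB : IsBlocking B)
    (hcard : B.ncard ≤ 2 * Fintype.card F - 1) :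
    ∀ P ∈ B, ¬ HasRInftyAt B P := by
  classical
  rintro P hP ⟨r, hPr, hT, hS⟩
  have hfin : Finite (Pt F) := inferInstance
  have huniq : ∀ Q ∈ B, Incid Q r → Q = P := fun Q hQ hQr => hT.unique ⟨hQ, hQr⟩ ⟨hP, hPr⟩
  have hblock : ∀ L : Ln F, L ≠ r → ∃ Q ∈ B, Q ≠ P ∧ Incid Q L := by
    intro L hL
    by_cases hPL : Incid P L
    · obtain ⟨X, Y, hXY, hX, hY, hXL, hYL⟩ := hS L hPL hL
      by_cases hXP : X = P
      · exact ⟨Y, hY, fun h => hXY (hXP.trans h.symm), hYL⟩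
      · exact ⟨X, hX, hXP, hXL⟩
    · obtain ⟨Q, hQ, hQL⟩ := hB.1 L
      exact ⟨Q, hQ, fun h => hPL (h ▸ hQL), hQL⟩
  choose w hw0 hwm hwS using fun a : Pt F => pt_gen a
  obtain ⟨Q, hQ, hQP⟩ : ∃ Q ∈ B, Q ≠ P := by
    obtain ⟨f, hf⟩ : ∃ f : (Fin 3 → F) →ₗ[F] F, f (w P) ≠ 0 := by
      obtain ⟨i, hi⟩ := Function.ne_iff.1 (hw0 P)
      exact ⟨LinearMap.proj i, by simpa using hi⟩
    obtain ⟨Q, hQ, hQL⟩ := hB.1 ⟨LinearMap.ker f, finrank_ker_two f _ hf⟩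
    refine ⟨Q, hQ, ?_⟩
    rintro rfl
    exact hf (hQL (hwm Q))
  have hQr : w Q ∉ r.1 := fun h => hQP (huniq Q hQ (hwS Q _ h))
  obtain ⟨φ, hφQ, hφr⟩ : ∃ φ : (Fin 3 → F) →ₗ[F] F, φ (w Q) = 1 ∧ LinearMap.ker φ = r.1 := by
    obtain ⟨f, hf, hle⟩ := Submodule.exists_le_ker_of_notMem hQr
    have hle' : r.1 ≤ LinearMap.ker ((f (w Q))⁻¹ • f) := by
      intro x hx
      have : f x = 0 := hle hx
      simp [this]
    have h1 : ((f (w Q))⁻¹ • f) (w Q) = 1 := by simp [hf]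
    refine ⟨(f (w Q))⁻¹ • f, h1, (Submodule.eq_of_le_of_finrank_eq hle' ?_).symm⟩
    rw [r.2, finrank_ker_two _ (w Q) (by rw [h1]; exact one_ne_zero)]
  let b := Module.finBasisOfFinrankEq F r.1 r.2
  let π : (Fin 3 → F) →ₗ[F] r.1 :=
    LinearMap.codRestrict r.1 (LinearMap.id - φ.smulRight (w Q)) (by
      intro c
      rw [← hφr]
      simp [hφQ])
  have hπQ : π (w Q) = 0 := by
    apply Subtype.ext
    simp [π, hφQ]
  have hπr : ∀ x : r.1, π x = x := by
    intro x
    have : φ x = 0 := hφr.ge x.2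
    apply Subtype.ext
    simp [π, this]
  let ψ : (Fin 2 → F) → (Fin 3 → F) →ₗ[F] F := fun x =>
    φ + ∑ i, x i • ((b.coord i).comp π)
  have hψQ : ∀ x, ψ x (w Q) = 1 := by
    intro x
    simp [ψ, hπQ, hφQ]
  let A : Finset (Pt F) := ((B \ {P}) \ {Q}).toFinite.toFinset
  have hA : A.card + 2 = B.ncard := by
    have h1 : A.card = ((B \ {P}) \ {Q}).ncard := (Set.ncard_eq_toFinset_card _ _).symm
    have h2 := Set.ncard_sdiff_singleton_add_one hP
    have h3 := Set.ncard_sdiff_singleton_add_one (s := B \ {P}) (a := Q) ⟨hQ, hQP⟩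
    omega
  let g : Pt F → MvPolynomial (Fin 2) F := fun a =>
    MvPolynomial.C (φ (w a)) + ∑ i, MvPolynomial.X i * MvPolynomial.C (b.coord i (π (w a)))
  have hg : ∀ a x, MvPolynomial.eval x (g a) = ψ x (w a) := by
    intro a x
    simp [g, ψ]
  have hgdeg : ∀ a, (g a).totalDegree ≤ 1 := by
    intro a
    refine (MvPolynomial.totalDegree_add _ _).trans (max_le (by simp) ?_)
    refine MvPolynomial.totalDegree_finsetSum_le fun i _ => ?_
    refine (MvPolynomial.totalDegree_mul _ _).trans ?_
    simp
  have hdeg : (∏ a ∈ A, g a).totalDegree ≤ A.card := by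
    refine (MvPolynomial.totalDegree_finsetProd _ _).trans ?_
    simpa using Finset.sum_le_card_nsmul A (fun a => (g a).totalDegree) 1 (fun a _ => hgdeg a)
  have hsum := MvPolynomial.sum_eval_eq_zero (∏ a ∈ A, g a) (by
    refine hdeg.trans_lt ?_
    simp
    omega)
  rw [Finset.sum_eq_single 0] at hsum
  · rw [MvPolynomial.eval_prod, Finset.prod_eq_zero_iff] at hsum
    obtain ⟨a, ha, h0⟩ := hsum
    rw [hg] at h0
    have h0' : φ (w a) = 0 := by simpa [ψ] using h0
    have haB : (a ∈ B ∧ a ≠ P) ∧ a ≠ Q := by simpa [A] using ha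
    refine haB.1.2 (huniq a haB.1.1 (hwS a _ ?_))
    rw [← hφr]
    exact h0'
  · intro x _ hx
    have hne : ψ x (w Q) ≠ 0 := by rw [hψQ]; exact one_ne_zero
    obtain ⟨a, haB, haP, haL⟩ := hblock ⟨LinearMap.ker (ψ x), finrank_ker_two _ _ hne⟩ (by
      intro h
      have h' : LinearMap.ker (ψ x) = r.1 := congrArg Subtype.val h
      apply hx
      funext i
      have h1 : ψ x (b i) = 0 := h'.ge (b i).2
      have h2 : φ (b i) = 0 := hφr.ge (b i).2
      simp only [ψ, LinearMap.add_apply, h2] at h1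
      fin_cases i <;> simpa [hπr, Finsupp.single_apply] using h1)
    have ha0 : ψ x (w a) = 0 := haL (hwm a)
    rw [MvPolynomial.eval_prod]
    refine Finset.prod_eq_zero (i := a) ?_ ((hg a x).trans ha0)
    have : a ≠ Q := by
      rintro rfl
      exact hne ha0
    simp [A, haB, haP, this]
  · intro h
    exact absurd (Finset.mem_univ _) h
end

section
/- Let q ≥ 5 be a prime power. For every integer k with 2q−1 ≤ k ≤ 3q−6 there exists a minimal affine blocking set of size k in the affine plane AG(2,q). -/
variable {F : Type} [Field F]

open Classical in
theorem transfer_aux (F : Type) [Field F] (l : Ln F) (T : Finset (F × F))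
    (hb : ∀ α β γ : F, (α ≠ 0 ∨ β ≠ 0) → ∃ p ∈ T, α * p.1 + β * p.2 + γ = 0)
    (hm : ∀ p ∈ T, ∃ α β γ : F, (α ≠ 0 ∨ β ≠ 0) ∧
      ∀ p' ∈ T, α * p'.1 + β * p'.2 + γ = 0 → p' = p) :
    ∃ B : Set (Pt F), IsMinimalAffBlocking l B ∧ B.ncard = T.card := by
  obtain ⟨l, hl⟩ := l
  have h3 : Module.finrank F (Fin 3 → F) = 3 := by simp
  have hker : ∀ m : Submodule F (Fin 3 → F), Module.finrank F m = 2 →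
      ∃ f : (Fin 3 → F) →ₗ[F] F, LinearMap.ker f = m := by
    intro m hm2
    have hlt : m < ⊤ := by
      rw [lt_top_iff_ne_top]; rintro rfl
      rw [finrank_top] at hm2; omega
    obtain ⟨f, hf0, hf⟩ := Submodule.exists_le_ker_of_lt_top m hlt
    refine ⟨f, (Submodule.eq_of_le_of_finrank_le hf ?_).symm⟩
    have hr := LinearMap.finrank_range_add_finrank_ker f
    have hs : LinearMap.range f = ⊤ := LinearMap.range_eq_top.2 (LinearMap.surjective hf0)
    rw [hs, finrank_top, h3, Module.finrank_self] at hr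
    omega
  obtain ⟨φ, hφ⟩ := hker l hl
  let bl := Module.finBasisOfFinrankEq F l hl
  have hb0 : φ (bl 0) = 0 := by
    exact LinearMap.mem_ker.1 (hφ.ge (bl 0).2)
  have hb1 : φ (bl 1) = 0 := by
    exact LinearMap.mem_ker.1 (hφ.ge (bl 1).2)
  have hne : ∃ v, φ v ≠ 0 := by
    by_contra! h
    have : l = ⊤ := by rw [← hφ]; ext v; simp [h]
    rw [this, finrank_top] at hl; omega
  obtain ⟨c, hc⟩ := hne
  set a : Fin 3 → F := (bl 0 : Fin 3 → F) with ha
  set b : Fin 3 → F := (bl 1 : Fin 3 → F) with hbdef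
  have hlab : ∀ f : (Fin 3 → F) →ₗ[F] F, f a = 0 → f b = 0 → ∀ v ∈ l, f v = 0 := by
    intro f h0 h1 v hv
    have := bl.sum_repr ⟨v, hv⟩
    have := congrArg (fun z : l => f z) this
    simp only [Fin.sum_univ_two, Submodule.coe_add, Submodule.coe_smul, map_add, map_smul] at this
    rw [← this, ← ha, ← hbdef, h0, h1]; simp
  -- linear independence
  have hli2 : ∀ x y : F, x • a + y • b = 0 → x = 0 ∧ y = 0 := by
    intro x y h
    have hli := bl.linearIndependent
    rw [Fintype.linearIndependent_iff] at hli
    have := hli ![x, y] (by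
      apply Subtype.ext
      simpa [Fin.sum_univ_two] using h)
    exact ⟨this 0, this 1⟩
  have hli : LinearIndependent F ![a, b, c] := by
    rw [Fintype.linearIndependent_iff]
    intro g hg
    simp only [Fin.sum_univ_three, Matrix.cons_val_zero, Matrix.cons_val_one,
      Matrix.cons_val] at hg
    have h2 : g 2 = 0 := by
      have := congrArg φ hg
      simp only [map_add, map_smul, hb0, hb1, map_zero, smul_eq_mul, mul_zero, zero_add] at this
      exact (mul_eq_zero.1 this).resolve_right hc
    rw [h2, zero_smul, add_zero] at hg
    obtain ⟨h0, h1⟩ := hli2 _ _ hg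
    intro i; fin_cases i <;> assumption
  let B3 := basisOfLinearIndependentOfCardEqFinrank hli (by simp)
  have hB3 : ⇑B3 = ![a, b, c] := coe_basisOfLinearIndependentOfCardEqFinrank hli (by simp)
  let v : F × F → (Fin 3 → F) := fun p => p.1 • a + p.2 • b + c
  have hφv : ∀ p, φ (v p) = φ c := by intro p; simp [v, hb0, hb1]
  have hv0 : ∀ p, v p ≠ 0 := by
    intro p h; apply hc; rw [← hφv p, h, map_zero]
  let P : F × F → Pt F := fun p => ⟨F ∙ v p, finrank_span_singleton (hv0 p)⟩
  have hinc : ∀ p (m : Ln F), Incid (P p) m ↔ v p ∈ m.1 := by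
    intro p m; simp [Incid, P, Submodule.span_singleton_le_iff_mem]
  have hPinj : Function.Injective P := by
    intro p p' h
    have h1 : v p ∈ F ∙ v p' := by
      have : (P p).1 = (P p').1 := by rw [h]
      change F ∙ v p = F ∙ v p' at this
      rw [← this]; exact Submodule.mem_span_singleton_self _
    obtain ⟨t, ht⟩ := Submodule.mem_span_singleton.1 h1
    have ht1 : t = 1 := by
      have := congrArg φ ht
      rw [map_smul, hφv, hφv, smul_eq_mul] at this
      exact mul_right_cancel₀ hc (by rw [this, one_mul])
    rw [ht1, one_smul] at ht
    have := hli2 (p'.1 - p.1) (p'.2 - p.2) (by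
      have : v p' - v p = 0 := by rw [ht, sub_self]
      rw [← this]; simp only [v]; module)
    exact Prod.ext (sub_eq_zero.1 this.1).symm (sub_eq_zero.1 this.2).symm
  have hfv : ∀ (f : (Fin 3 → F) →ₗ[F] F) p, f (v p) = f a * p.1 + f b * p.2 + f c := by
    intro f p; simp [v]; ring
  refine ⟨P '' T, ⟨⟨?_, ?_⟩, ?_⟩, ?_⟩
  · rintro _ ⟨p, -, rfl⟩ h
    rw [hinc] at h
    change v p ∈ l at h
    rw [← hφ, LinearMap.mem_ker, hφv] at h
    exact hc h
  · intro m hml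
    obtain ⟨f, hf⟩ := hker m.1 m.2
    have hab : f a ≠ 0 ∨ f b ≠ 0 := by
      by_contra! h
      apply hml
      apply Subtype.ext
      symm
      apply Submodule.eq_of_le_of_finrank_eq
      · intro x hx
        rw [← hf]; exact hlab f h.1 h.2 x hx
      · change Module.finrank F l = _
        rw [hl, m.2]
    obtain ⟨p, hp, h⟩ := hb (f a) (f b) (f c) hab
    refine ⟨P p, ⟨p, hp, rfl⟩, ?_⟩
    rw [hinc, ← hf, LinearMap.mem_ker, hfv, h]
  · intro B' hB' hbl
    obtain ⟨hsub, Q, hQ, hQB⟩ := Set.ssubset_iff_exists.1 hB'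
    obtain ⟨p, hp, rfl⟩ := hQ
    obtain ⟨α, β, γ, hab, hu⟩ := hm p hp
    let f : (Fin 3 → F) →ₗ[F] F := B3.constr F ![α, β, γ]
    have fa : f a = α := by
      have := B3.constr_basis F ![α, β, γ] 0; rw [hB3] at this; exact this
    have fb : f b = β := by
      have := B3.constr_basis F ![α, β, γ] 1; rw [hB3] at this; exact this
    have fc : f c = γ := by
      have := B3.constr_basis F ![α, β, γ] 2; rw [hB3] at this; exact this
    have hf0 : f ≠ 0 := by
      intro h; rw [h] at fa fb
      rcases hab with h | h
      · exact h fa.symm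
      · exact h fb.symm
    have hk2 : Module.finrank F (LinearMap.ker f) = 2 := by
      have hr := LinearMap.finrank_range_add_finrank_ker f
      have hs : LinearMap.range f = ⊤ := LinearMap.range_eq_top.2 (LinearMap.surjective hf0)
      rw [hs, finrank_top, h3, Module.finrank_self] at hr
      omega
    obtain ⟨Q, hQ, hi⟩ := hbl.2 ⟨LinearMap.ker f, hk2⟩ (by
      intro h
      have h' : LinearMap.ker f = l := congrArg Subtype.val h
      have ha' : f a = 0 := by
        have : a ∈ l := (bl 0).2
        rw [← h'] at this; exact this
      have hb' : f b = 0 := by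
        have : b ∈ l := (bl 1).2
        rw [← h'] at this; exact this
      rw [fa] at ha'; rw [fb] at hb'
      tauto)
    obtain ⟨p', hp', rfl⟩ := hsub hQ
    rw [hinc] at hi
    change f (v p') = 0 at hi
    rw [hfv, fa, fb, fc] at hi
    rw [hu p' hp' hi] at hQ
    exact hQB hQ
  · rw [Set.ncard_image_of_injective _ hPinj, Set.ncard_coe_finset]

open Classical in
theorem exists_T_aux (F : Type) [Field F] [Fintype F] (N : Finset F) (h0 : (0:F) ∉ N)
    (h1 : (1:F) ∉ N) (hN2 : N.card + 3 ≤ Fintype.card F)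
    (w : F) (hw : w ∈ N) (hw2 : 2 * w = 1 ∨ (2:F) = 0) :
    ∃ T : Finset (F × F), T.card + N.card + 4 = 3 * Fintype.card F ∧
    (∀ α β γ : F, (α ≠ 0 ∨ β ≠ 0) → ∃ p ∈ T, α * p.1 + β * p.2 + γ = 0) ∧
    (∀ p ∈ T, ∃ α β γ : F, (α ≠ 0 ∨ β ≠ 0) ∧
      ∀ p' ∈ T, α * p'.1 + β * p'.2 + γ = 0 → p' = p) := by
  have hn0 : ∀ y ∈ N, y ≠ 0 := fun y hy h => h0 (h ▸ hy)
  have hn1 : ∀ y ∈ N, y ≠ 1 := fun y hy h => h1 (h ▸ hy)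
  let I := N.image (fun y => y⁻¹ - 1)
  have hI : ∀ s, s ∈ I ↔ ∃ y ∈ N, y⁻¹ - 1 = s := by intro s; simp [I]
  have hIc : I.card = N.card := Finset.card_image_of_injective _ (fun x y h => by
    simpa using h)
  let A := (Finset.univ.erase (0:F)) \ I
  have hA : ∀ s, s ∈ A ↔ s ≠ 0 ∧ s ∉ I := by intro s; simp [A]
  have hAc : A.card = Fintype.card F - 1 - N.card := by
    rw [Finset.card_sdiff_of_subset, hIc, Finset.card_erase_of_mem (Finset.mem_univ _),
      Finset.card_univ]
    intro s hs
    obtain ⟨y, hy, rfl⟩ := (hI s).1 hs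
    simp only [Finset.mem_erase, Finset.mem_univ, and_true]
    intro h
    apply hn1 y hy
    rw [sub_eq_zero] at h
    exact inv_eq_one.1 h
  let C := ((Finset.univ.erase (0:F)).erase 1) \ N
  have hC : ∀ s, s ∈ C ↔ s ≠ 1 ∧ s ≠ 0 ∧ s ∉ N := by intro s; simp [C, and_assoc]
  have hCc : C.card = Fintype.card F - 1 - 1 - N.card := by
    rw [Finset.card_sdiff_of_subset, Finset.card_erase_of_mem (by simp),
      Finset.card_erase_of_mem (Finset.mem_univ _), Finset.card_univ]
    intro s hs
    simp [hn1 s hs, hn0 s hs]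
  let R := Finset.univ.erase (0:F)
  have hR : ∀ s, s ∈ R ↔ s ≠ 0 := by intro s; simp [R]
  have hRc : R.card = Fintype.card F - 1 := by
    rw [Finset.card_erase_of_mem (Finset.mem_univ _), Finset.card_univ]
  obtain ⟨a0, ha0⟩ : A.Nonempty := Finset.card_pos.1 (by omega)
  obtain ⟨c0, hc0⟩ : C.Nonempty := Finset.card_pos.1 (by omega)
  let T1 := R.image (fun r => (r, (0:F)))
  let T2 := A.image (fun s => (s, (1:F)))
  let T3 := C.image (fun v => ((0:F), v))
  let T4 := N.image (fun y => (1 - y, y))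
  have m1 : ∀ p, p ∈ T1 ↔ p.1 ≠ 0 ∧ p.2 = 0 := by
    rintro ⟨x, y⟩; simp [T1, hR]; grind
  have m2 : ∀ p, p ∈ T2 ↔ p.1 ∈ A ∧ p.2 = 1 := by
    rintro ⟨x, y⟩; simp [T2]; grind
  have m3 : ∀ p, p ∈ T3 ↔ p.2 ∈ C ∧ p.1 = 0 := by
    rintro ⟨x, y⟩; simp [T3]; grind
  have m4 : ∀ p, p ∈ T4 ↔ p.2 ∈ N ∧ p.1 = 1 - p.2 := by
    rintro ⟨x, y⟩; simp [T4]; grind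
  have mT : ∀ p, p ∈ T1 ∪ T2 ∪ T3 ∪ T4 ↔ (p.1 ≠ 0 ∧ p.2 = 0) ∨ (p.1 ∈ A ∧ p.2 = 1) ∨
      (p.2 ∈ C ∧ p.1 = 0) ∨ (p.2 ∈ N ∧ p.1 = 1 - p.2) := by
    intro p; simp only [Finset.mem_union, m1, m2, m3, m4, or_assoc]
  have ms : ∀ s y, s ∈ A → y ∈ N → s * y ≠ 1 - y := by
    intro s y hs hy h
    apply ((hA s).1 hs).2
    refine (hI s).2 ⟨y, hy, ?_⟩
    have := hn0 y hy
    field_simp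
    rw [← h]; ring
  refine ⟨T1 ∪ T2 ∪ T3 ∪ T4, ?_, ?_, ?_⟩
  · have c1 : T1.card = R.card := Finset.card_image_of_injective _ (fun x y h => by simpa using h)
    have c2 : T2.card = A.card := Finset.card_image_of_injective _ (fun x y h => by simpa using h)
    have c3 : T3.card = C.card := Finset.card_image_of_injective _ (fun x y h => by simpa using h)
    have c4 : T4.card = N.card := Finset.card_image_of_injective _ (fun x y h => by
      simpa using (Prod.ext_iff.1 h).2)
    rw [Finset.card_union_of_disjoint, Finset.card_union_of_disjoint,
      Finset.card_union_of_disjoint, c1, c2, c3, c4]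
    · omega
    · rw [Finset.disjoint_left]; intro p; rw [m1, m2]; grind
    · rw [Finset.disjoint_left]; intro p; rw [Finset.mem_union, m1, m2, m3]; grind
    · rw [Finset.disjoint_left]; intro p; rw [Finset.mem_union, Finset.mem_union, m1, m2, m3, m4]
      grind
  · intro α β γ hab
    by_cases hα : α = 0
    · subst hα
      have hβ : β ≠ 0 := by tauto
      obtain ⟨c, rfl⟩ : ∃ c, γ = - (β * c) := ⟨-γ / β, by field_simp⟩
      by_cases hc : c = 0
      · exact ⟨(1, 0), (mT _).2 (by simp), by simp [hc]⟩
      by_cases hc' : c = 1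
      · exact ⟨(a0, 1), (mT _).2 (by simp [ha0]), by simp [hc']⟩
      by_cases hcN : c ∈ N
      · exact ⟨(1 - c, c), (mT _).2 (by simp [hcN]), by simp⟩
      · exact ⟨(0, c), (mT _).2 (by simp [hC, hc, hc', hcN]), by simp⟩
    · by_cases hγ : γ = 0
      · subst hγ
        obtain ⟨d, rfl⟩ : ∃ d, β = - (α * d) := ⟨-β / α, by field_simp⟩
        by_cases hd : d = 0
        · exact ⟨(0, c0), (mT _).2 (by simp [hc0]), by simp [hd]⟩
        by_cases hdI : d ∈ I
        · obtain ⟨y, hy, rfl⟩ := (hI d).1 hdI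
          have := hn0 y hy
          refine ⟨(1 - y, y), (mT _).2 (by simp [hy]), ?_⟩
          simp only; field_simp; ring
        · exact ⟨(d, 1), (mT _).2 (by simp [hA, hd, hdI]), by simp⟩
      · refine ⟨(-γ / α, 0), (mT _).2 (by simp [hα, hγ]), ?_⟩
        simp only; field_simp; ring
  · rintro ⟨x, y⟩ hp
    rw [mT] at hp
    rcases hp with ⟨hx, hy⟩ | ⟨hx, hy⟩ | ⟨hy, hx⟩ | ⟨hy, hx⟩
    · simp only at hx hy
      subst hy
      by_cases hx1 : x = 1
      · subst hx1
        rcases hw2 with hw2 | hw2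
        · refine ⟨1, 0, -1, by simp, ?_⟩
          rintro ⟨x', y'⟩ hp' he
          rw [mT] at hp'
          simp only at hp' he
          rcases hp' with h | h | h | h
          · ext <;> simp <;> grind
          · exact absurd (by grind) (ms x' w h.1 hw)
          · grind
          · have := hn0 y' h.1
            grind
        · refine ⟨w, -1, -w, by simp, ?_⟩
          have hw0 := hn0 w hw
          have hw1 := hn1 w hw
          rintro ⟨x', y'⟩ hp' he
          rw [mT] at hp'
          simp only at hp' he
          rcases hp' with h | h | h | h
          · have : x' = 1 := by
              apply mul_left_cancel₀ hw0; rw [h.2] at he; linear_combination he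
            rw [this, h.2]
          · exact absurd (by rw [h.2] at he; linear_combination he + w * hw2) (ms x' w h.1 hw)
          · have : y' = w := by rw [h.2] at he; linear_combination -he - w * hw2
            exact absurd hw (this ▸ ((hC _).1 h.1).2.2)
          · have h3 : y' * (1 + w) = 0 := by rw [h.2] at he; linear_combination -he
            rcases mul_eq_zero.1 h3 with h4 | h4
            · exact absurd h4 (hn0 _ h.1)
            · exact absurd (by linear_combination h4 - hw2) hw1
      · refine ⟨1, x, -x, by simp, ?_⟩
        rintro ⟨x', y'⟩ hp' he
        rw [mT] at hp'
        simp only at hp' he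
        rcases hp' with h | h | h | h
        · rw [h.2] at he ⊢
          ext
          · simp only; linear_combination he
          · rfl
        · exact absurd (by rw [h.2] at he; linear_combination he) ((hA _).1 h.1).1
        · exfalso
          apply ((hC _).1 h.1).1
          apply mul_left_cancel₀ hx
          rw [h.2] at he; linear_combination he
        · have h3 : (1 - y') * (1 - x) = 0 := by rw [h.2] at he; linear_combination he
          rcases mul_eq_zero.1 h3 with h4 | h4
          · exact absurd (by linear_combination -h4) (hn1 _ h.1)
          · exact absurd (by linear_combination -h4) hx1
    · simp only at hx hy
      subst hy
      refine ⟨1, -x, 0, by simp, ?_⟩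
      have hx0 := ((hA _).1 hx).1
      rintro ⟨x', y'⟩ hp' he
      rw [mT] at hp'
      simp only at hp' he
      rcases hp' with h | h | h | h
      · exact absurd (by rw [h.2] at he; linear_combination he) h.1
      · rw [h.2] at he ⊢
        ext
        · simp only; linear_combination he
        · rfl
      · exfalso
        apply ((hC _).1 h.1).2.1
        apply mul_left_cancel₀ hx0
        rw [h.2] at he; linear_combination -he
      · exact absurd (by rw [h.2] at he; linear_combination -he) (ms x y' hx h.1)
    · simp only at hx hy
      subst hx
      refine ⟨0, 1, -y, by simp, ?_⟩
      have hy' := (hC _).1 hy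
      rintro ⟨x', y'⟩ hp' he
      have : y' = y := by simp only at he; linear_combination he
      subst this
      rw [mT] at hp'
      simp only at hp'
      rcases hp' with h | h | h | h
      · tauto
      · tauto
      · rw [h.2]
      · tauto
    · simp only at hx hy
      subst hx
      refine ⟨0, 1, -y, by simp, ?_⟩
      have hy0 := hn0 _ hy
      have hy1 := hn1 _ hy
      rintro ⟨x', y'⟩ hp' he
      have : y' = y := by simp only at he; linear_combination he
      subst this
      rw [mT] at hp'
      simp only at hp'
      rcases hp' with h | h | h | h
      · tauto
      · tauto
      · have := (hC _).1 h.1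
        tauto
      · rw [h.2]

/-- For `q ≥ 5` and every `2q-1 ≤ k ≤ 3q-6` there is a minimal affine blocking set of
size `k` in AG(2,q). -/
theorem exists_minimalAffBlocking
    (F : Type) [Field F] [Fintype F] (hq : 5 ≤ Fintype.card F)
    (l : Ln F) (k : ℕ)
    (hk1 : 2 * Fintype.card F - 1 ≤ k) (hk2 : k ≤ 3 * Fintype.card F - 6) :
    ∃ B : Set (Pt F), IsMinimalAffBlocking l B ∧ B.ncard = k := by
  classical
  have hUc : ((Finset.univ.erase (0:F)).erase 1).card = Fintype.card F - 1 - 1 := by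
    rw [Finset.card_erase_of_mem (by simp),
      Finset.card_erase_of_mem (Finset.mem_univ _), Finset.card_univ]
  obtain ⟨w, hwU, hw2⟩ : ∃ w ∈ (Finset.univ.erase (0:F)).erase 1, 2 * w = 1 ∨ (2:F) = 0 := by
    by_cases h2 : (2:F) = 0
    · obtain ⟨w, hw⟩ : ((Finset.univ.erase (0:F)).erase 1).Nonempty :=
        Finset.card_pos.1 (by omega)
      exact ⟨w, hw, Or.inr h2⟩
    · refine ⟨2⁻¹, ?_, Or.inl (mul_inv_cancel₀ h2)⟩
      simp only [Finset.mem_erase, Finset.mem_univ, and_true]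
      refine ⟨?_, inv_ne_zero h2⟩
      intro h
      rw [inv_eq_one] at h
      exact one_ne_zero (α := F) (by linear_combination h)
  obtain ⟨N, hwN, hNU, hNc⟩ := Finset.exists_subsuperset_card_eq
    (s := {w}) (t := (Finset.univ.erase (0:F)).erase 1) (n := 3 * Fintype.card F - 4 - k)
    (by simpa using hwU) (by simp; omega) (by omega)
  obtain ⟨T, hT, hb, hm⟩ := exists_T_aux F N (fun h => by simpa using hNU h)
    (fun h => by simpa using hNU h) (by omega) w (hwN (by simp)) hw2
  obtain ⟨B, hB, hBc⟩ := transfer_aux F l T hb hm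
  exact ⟨B, hB, by omega⟩
end
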